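/- For every integer n with 107 ≤ n ≤ 193 there exists a conflict collection of n-vertex graphs of cardinality at most 30. In particular, there exists a conflict collection consisting of 30 planar-embeddable graphs. -/

import Mathlib

noncomputable section

/-- The Euclidean plane. -/
abbrev Plane := EuclideanSpace ℝ (Fin 2)

/-- `π` is a straight-line embedding of the simple graph `G` in the plane:
it is injective, the closed segments of two distinct edges meet only in images of
common endpoints, and no vertex image lies in the open segment of a non-incident edge. -/
def IsSLEmbedding {V : Type*} (G : SimpleGraph V) (π : V → Plane) : Prop :=
  Function.Injective π ∧
  (∀ u v x y : V, G.Adj u v → G.Adj x y → s(u, v) ≠ s(x, y) →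
    segment ℝ (π u) (π v) ∩ segment ℝ (π x) (π y) ⊆ π '' (({u, v} : Set V) ∩ ({x, y} : Set V))) ∧
  (∀ u v w : V, G.Adj u v → w ≠ u → w ≠ v → π w ∉ openSegment ℝ (π u) (π v))

/-- `G` embeds straight-line on the point set `P`. -/
def EmbedsOn {V : Type*} (G : SimpleGraph V) (P : Set Plane) : Prop :=
  ∃ π : V → Plane, IsSLEmbedding G π ∧ Set.range π = P

/-- `G` embeds straight-line on some point set (equivalently, `G` is planar). -/
def PlanarEmbeddable {V : Type*} (G : SimpleGraph V) : Prop :=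
  ∃ π : V → Plane, IsSLEmbedding G π

/-- A family of graphs on `n` vertices is simultaneously embeddable if there is a point
set of size `n` on which every member embeds straight-line. -/
def SimultaneouslyEmbeddable {n : ℕ} (𝒢 : Set (SimpleGraph (Fin n))) : Prop :=
  ∃ P : Finset Plane, P.card = n ∧ ∀ G ∈ 𝒢, EmbedsOn G ↑P

/-- A conflict collection: a family of planar-embeddable graphs on `n` vertices that is
not simultaneously embeddable. -/
def ConflictCollection {n : ℕ} (𝒢 : Set (SimpleGraph (Fin n))) : Prop :=
  (∀ G ∈ 𝒢, PlanarEmbeddable G) ∧ ¬ SimultaneouslyEmbeddable 𝒢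

/-- Square Cauchy matrices are nonsingular. -/
theorem cauchy_det_ne_zero {ι : Type*} [Fintype ι] [DecidableEq ι] (a b : ι → ℝ)
    (ha : Function.Injective a) (hb : Function.Injective b) (hab : ∀ i j, a i + b j ≠ 0) :
    (Matrix.of fun i j => (a i + b j)⁻¹).det ≠ 0 := by
  intro hdet
  obtain ⟨v, hv0, hv⟩ := Matrix.exists_mulVec_eq_zero_iff.2 hdet
  apply hv0
  let p : Polynomial ℝ := ∑ j, Polynomial.C (v j) *
    ∏ l ∈ Finset.univ.erase j, (Polynomial.X + Polynomial.C (b l))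
  have hp : p = 0 := by
    apply Polynomial.eq_zero_of_natDegree_lt_card_of_eval_eq_zero p ha
    · intro i
      have h := congrFun hv i
      simp only [Matrix.mulVec, dotProduct, Matrix.of_apply, Pi.zero_apply] at h
      have : p.eval (a i) = (∏ l, (a i + b l)) * ∑ j, (a i + b j)⁻¹ * v j := by
        simp only [p, Polynomial.eval_finsetSum, Polynomial.eval_mul, Polynomial.eval_C,
          Polynomial.eval_prod, Polynomial.eval_add, Polynomial.eval_X, Finset.mul_sum]
        refine Finset.sum_congr rfl fun j _ => ?_
        rw [← Finset.mul_prod_erase Finset.univ _ (Finset.mem_univ j)]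
        field_simp [hab i j]
      rw [this, h, mul_zero]
    · by_cases hι : Nonempty ι
      · refine lt_of_le_of_lt (Polynomial.natDegree_sum_le_of_forall_le (n := Fintype.card ι - 1)
          _ _ fun j _ => ?_) (Nat.sub_lt Fintype.card_pos one_pos)
        refine (Polynomial.natDegree_C_mul_le _ _).trans
          ((Polynomial.natDegree_prod_le _ _).trans ?_)
        simp [Finset.card_erase_of_mem]
      · exact absurd (funext fun i => (hι ⟨i⟩).elim) hv0
  funext j
  have h : p.eval (-b j) = 0 := by rw [hp, Polynomial.eval_zero]
  simp only [p, Polynomial.eval_finsetSum, Polynomial.eval_mul, Polynomial.eval_C,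
    Polynomial.eval_prod, Polynomial.eval_add, Polynomial.eval_X] at h
  rw [Finset.sum_eq_single j] at h
  · refine (mul_eq_zero.1 h).resolve_right (Finset.prod_ne_zero_iff.2 fun l hl => ?_)
    have : b l ≠ b j := fun h => (Finset.ne_of_mem_erase hl) (hb h)
    intro h'
    exact this (by linarith)
  · intro i _ hij
    rw [Finset.prod_eq_zero (Finset.mem_erase.2 ⟨hij.symm, Finset.mem_univ j⟩) (by ring), mul_zero]
  · simp

/-- Every square submatrix using all rows of `c` is nonsingular. -/
def FullMinors {κ ι : Type*} [Fintype κ] [DecidableEq κ] (c : κ → ι → ℝ) : Prop :=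
  ∀ f : κ → ι, Function.Injective f → (Matrix.of fun j j' => c j (f j')).det ≠ 0

theorem FullMinors.exists_col_comb {κ ι : Type*} [Fintype κ] [DecidableEq κ] [DecidableEq ι]
    {c : κ → ι → ℝ} (hc : FullMinors c) {B : Finset ι} (hB : B.card = Fintype.card κ) (j : κ) :
    ∃ μ : ι → ℝ, ∀ j', ∑ i ∈ B, μ i * c j' i = if j' = j then 1 else 0 := by
  obtain ⟨f⟩ : Nonempty (κ ≃ B) := ⟨Fintype.equivOfCardEq (by simp [hB])⟩
  have hdet := hc (fun j => (f j : ι)) (Subtype.val_injective.comp f.injective)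
  set M := Matrix.of fun j j' => c j (f j') with hM
  refine ⟨fun i => if h : i ∈ B then M⁻¹ (f.symm ⟨i, h⟩) j else 0, fun j' => ?_⟩
  have h := congrFun (congrFun (Matrix.mul_nonsing_inv M (isUnit_iff_ne_zero.2 hdet)) j') j
  rw [Matrix.mul_apply, Matrix.one_apply] at h
  rw [← h, ← Finset.sum_coe_sort B, ← f.sum_comp]
  simp [hM, mul_comm]

theorem FullMinors.exists_row_comb {κ ι : Type*} [Fintype κ] [DecidableEq κ] [DecidableEq ι]
    {c : κ → ι → ℝ} (hc : FullMinors c) {B : Finset ι} (hB : B.card = Fintype.card κ)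
    {i : ι} (hi : i ∈ B) :
    ∃ ν : κ → ℝ, ∀ i' ∈ B, ∑ j, ν j * c j i' = if i' = i then 1 else 0 := by
  obtain ⟨f⟩ : Nonempty (κ ≃ B) := ⟨Fintype.equivOfCardEq (by simp [hB])⟩
  have hdet := hc (fun j => (f j : ι)) (Subtype.val_injective.comp f.injective)
  set M := Matrix.of fun j j' => c j (f j') with hM
  refine ⟨fun j => M⁻¹ (f.symm ⟨i, hi⟩) j, fun i' hi' => ?_⟩
  have h := congrFun (congrFun (Matrix.nonsing_inv_mul M (isUnit_iff_ne_zero.2 hdet))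
    (f.symm ⟨i, hi⟩)) (f.symm ⟨i', hi'⟩)
  rw [Matrix.mul_apply, Matrix.one_apply] at h
  simp only [hM, Matrix.of_apply, Equiv.apply_symm_apply, EmbeddingLike.apply_eq_iff_eq,
    Subtype.mk.injEq] at h
  rw [h]
  simp only [eq_comm]

/-- The weight of an exponent vector. -/
def expWeight {N : ℕ} (w : Fin N → ℕ) (α : Fin N → ℕ) : ℕ := ∑ i, w i * α i

/-- All monomials of `r` have weight less than `D`. -/
def LowWeight {N : ℕ} (w : Fin N → ℕ) (D : ℕ) (r : MvPolynomial (Fin N) ℝ) : Prop :=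
  ∀ β ∈ r.support, expWeight w β < D

theorem LowWeight.pderiv {N : ℕ} {w : Fin N → ℕ} {D : ℕ} {r : MvPolynomial (Fin N) ℝ}
    (hr : LowWeight w D r) (i : Fin N) {β : Fin N →₀ ℕ}
    (hβ : β ∈ (MvPolynomial.pderiv i r).support) : expWeight w β + w i < D := by
  rw [MvPolynomial.mem_support_iff, MvPolynomial.coeff_pderiv] at hβ
  have h := hr (β + Finsupp.single i 1) (MvPolynomial.mem_support_iff.2 fun h => hβ (by simp [h]))
  have : expWeight w (β + Finsupp.single i 1 : Fin N →₀ ℕ) = expWeight w β + w i := by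
    simp [expWeight, mul_add, Finset.sum_add_distrib, Finsupp.single_apply]
  omega

/-- The coordinates at which an exponent vector is divisible by the leading term of a
partial derivative. -/
def largeSet {N : ℕ} (e : Fin N → ℕ) (α : Fin N → ℕ) : Finset (Fin N) :=
  Finset.univ.filter fun i => e i ≤ α i + 1

/-- Exponent vectors that cannot be reduced further modulo the Lagrange system of `k`
constraints. -/
def Reduced {N : ℕ} (e : Fin N → ℕ) (k : ℕ) (α : Fin N → ℕ) : Prop :=
  (largeSet e α).card ≤ k ∧ ∀ i, α i + 1 < 2 * e i ∧
    (e i ≤ α i → k < (Finset.Iic i \ largeSet e α).card + (largeSet e α).card)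

theorem exists_top_subset {α : Type*} [LinearOrder α] (S : Finset α) (t : ℕ) (ht : t ≤ S.card) :
    ∃ T ⊆ S, T.card = t ∧ ∀ i ∈ S, i ∉ T → ∀ l ∈ T, i < l := by
  induction t with
  | zero => exact ⟨∅, by simp⟩
  | succ t ih =>
    obtain ⟨T, hTS, hT, h⟩ := ih (by omega)
    have hne : (S \ T).Nonempty := by
      rw [← Finset.card_pos, Finset.card_sdiff_of_subset hTS]; omega
    have hmem := Finset.mem_sdiff.1 ((S \ T).max'_mem hne)
    refine ⟨insert ((S \ T).max' hne) T, Finset.insert_subset hmem.1 hTS, ?_, ?_⟩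
    · rw [Finset.card_insert_of_notMem hmem.2, hT]
    · intro i hi hiT l hl
      rw [Finset.mem_insert, not_or] at hiT
      rcases Finset.mem_insert.1 hl with rfl | hl
      · exact lt_of_le_of_ne (Finset.le_max' _ _ (Finset.mem_sdiff.2 ⟨hi, hiT.2⟩)) hiT.1
      · exact h i hi hiT.2 l hl

theorem reduced_finite_card {N : ℕ} (e : Fin N → ℕ) (he : ∀ i, 0 < e i) {k : ℕ} (hk : k ≤ N) :
    {α | Reduced e k α}.Finite ∧
      {α | Reduced e k α}.ncard ≤ N.choose k * ∏ i, e i := by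
  classical
  have hex : ∀ α : Fin N → ℕ, ∃ T : Finset (Fin N), Reduced e k α →
      T.card = N - k ∧ T ⊆ (largeSet e α)ᶜ ∧
        ∀ i ∈ (largeSet e α)ᶜ, i ∉ T → ∀ l ∈ T, i < l := by
    intro α
    by_cases hα : Reduced e k α
    · obtain ⟨T, h1, h2, h3⟩ := exists_top_subset (largeSet e α)ᶜ (N - k) (by
        rw [Finset.card_compl, Fintype.card_fin]; have := hα.1; omega)
      exact ⟨T, fun _ => ⟨h2, h1, h3⟩⟩
    · exact ⟨∅, fun h => (hα h).elim⟩
  choose T hT using hex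
  let S : Finset (Finset (Fin N) × (Fin N → ℕ)) :=
    (Finset.powersetCard (N - k) Finset.univ) ×ˢ Fintype.piFinset fun i => Finset.range (e i)
  let Φ : (Fin N → ℕ) → Finset (Fin N) × (Fin N → ℕ) := fun α => (T α, fun i => α i % e i)
  have hmaps : Set.MapsTo Φ {α | Reduced e k α} S := by
    intro α hα
    simp only [S, Φ, Finset.coe_product, Set.mem_prod, Finset.mem_coe, Finset.mem_powersetCard,
      Fintype.mem_piFinset, Finset.mem_range]
    exact ⟨⟨Finset.subset_univ _, (hT α hα).1⟩, fun i => Nat.mod_lt _ (he i)⟩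
  have hlow : ∀ α, Reduced e k α → ∀ i, (i ∈ T α ∨ ∀ l ∈ T α, i < l) → α i < e i := by
    intro α hα i hi
    obtain ⟨hc, hs, -⟩ := hT α hα
    rcases hi with hi | hi
    · have := hs hi
      simp only [largeSet, Finset.mem_compl, Finset.mem_filter, Finset.mem_univ, true_and] at this
      omega
    · by_contra hge
      have h1 := (hα.2 i).2 (by omega)
      have h2 : Disjoint (Finset.Iic i \ largeSet e α) (T α) := by
        rw [Finset.disjoint_left]
        intro l hl hlT
        have := hi l hlT
        simp only [Finset.mem_sdiff, Finset.mem_Iic] at hl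
        exact absurd hl.1 (not_le.2 this)
      have h3 := Finset.card_le_card (Finset.union_subset
        (fun l hl => Finset.mem_compl.2 (Finset.mem_sdiff.1 hl).2) hs :
          (Finset.Iic i \ largeSet e α) ∪ T α ⊆ (largeSet e α)ᶜ)
      rw [Finset.card_union_of_disjoint h2, Finset.card_compl, Fintype.card_fin, hc] at h3
      have := (Finset.card_le_univ (largeSet e α)).trans_eq (Fintype.card_fin N)
      omega
  have hhigh : ∀ α, Reduced e k α → ∀ i, ¬ (i ∈ T α ∨ ∀ l ∈ T α, i < l) →
      e i ≤ α i + 1 ∧ α i + 1 < 2 * e i := by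
    intro α hα i hi
    refine ⟨?_, (hα.2 i).1⟩
    by_contra hlt
    push Not at hi
    obtain ⟨hiT, l, hl, hli⟩ := hi
    have := (hT α hα).2.2 i (by simp [largeSet]; omega) hiT l hl
    exact absurd this (not_lt.2 hli)
  have hinj : Set.InjOn Φ {α | Reduced e k α} := by
    intro α hα β hβ h
    simp only [Φ, Prod.mk.injEq] at h
    funext i
    have hmod : α i ≡ β i [MOD e i] := congrFun h.2 i
    have hTT : (i ∈ T α ∨ ∀ l ∈ T α, i < l) ↔ (i ∈ T β ∨ ∀ l ∈ T β, i < l) := by rw [h.1]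
    by_cases hi : i ∈ T α ∨ ∀ l ∈ T α, i < l
    · have h1 := hlow α hα i hi
      have h2 := hlow β hβ i (hTT.1 hi)
      exact Nat.ModEq.eq_of_lt_of_lt hmod h1 h2
    · have h1 := hhigh α hα i hi
      have h2 := hhigh β hβ i (fun h => hi (hTT.2 h))
      exact Nat.ModEq.eq_of_abs_lt hmod (abs_lt.2 ⟨by omega, by omega⟩)
  have hfin : {α | Reduced e k α}.Finite := Set.Finite.of_injOn hmaps hinj S.finite_toSet
  refine ⟨hfin, ?_⟩
  have h := Set.ncard_le_ncard_of_injOn Φ hmaps hinj S.finite_toSet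
  rw [Set.ncard_coe_finset] at h
  refine h.trans ?_
  simp [S, Finset.card_product, Fintype.card_piFinset, Nat.choose_symm hk]

/-- Replace a factor `x i ^ e i` of a monomial by `x l ^ e l`. -/
def moveExp {N : ℕ} (e : Fin N → ℕ) (α : Fin N → ℕ) (i l : Fin N) : Fin N → ℕ :=
  fun s => (α s - if s = i then e i else 0) + if s = l then e l else 0

theorem expWeight_moveExp {N : ℕ} {e w : Fin N → ℕ} {D : ℕ} (hD : ∀ i, w i * e i = D)
    (α : Fin N → ℕ) {i : Fin N} (hi : e i ≤ α i) (l : Fin N) :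
    expWeight w (moveExp e α i l) = expWeight w α := by
  have h : ∀ s, w s * moveExp e α i l s + (if s = i then D else 0)
      = w s * α s + if s = l then D else 0 := by
    intro s
    have h1 : (α s - if s = i then e i else 0) + (if s = i then e i else 0) = α s := by
      split_ifs with h
      · subst h; omega
      · omega
    have h2 : ∀ t, (if s = t then D else 0) = w s * (if s = t then e t else 0) := by
      intro t; split_ifs with h
      · subst h; exact (hD s).symm
      · simp
    rw [h2, h2, moveExp, mul_add, add_right_comm, ← mul_add, h1]
  have := Finset.sum_congr rfl fun s (_ : s ∈ Finset.univ) => h s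
  rw [Finset.sum_add_distrib, Finset.sum_add_distrib] at this
  simpa [expWeight] using this

theorem expWeight_sub {N : ℕ} (w α : Fin N → ℕ) (i : Fin N) {a : ℕ} (ha : a ≤ α i) :
    expWeight w (fun s => α s - if s = i then a else 0) + w i * a = expWeight w α := by
  have h : w i * a = ∑ s, w s * (if s = i then a else 0) := by simp
  rw [h, expWeight, expWeight, ← Finset.sum_add_distrib]
  refine Finset.sum_congr rfl fun s _ => ?_
  rw [← mul_add]
  congr 1
  split_ifs with hs
  · subst hs; omega
  · omega

theorem prod_pow_sub {N : ℕ} (x : Fin N → ℝ) (α : Fin N → ℕ) (i : Fin N) {a : ℕ} (ha : a ≤ α i) :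
    (∏ s, x s ^ (α s - if s = i then a else 0)) * x i ^ a = ∏ s, x s ^ α s := by
  have h : x i ^ a = ∏ s, x s ^ (if s = i then a else 0) := by simp
  rw [h, ← Finset.prod_mul_distrib]
  refine Finset.prod_congr rfl fun s _ => ?_
  rw [← pow_add]
  congr 1
  split_ifs with hs
  · subst hs; omega
  · omega

theorem prod_pow_moveExp {N : ℕ} (e : Fin N → ℕ) (x : Fin N → ℝ) (α : Fin N → ℕ) (i l : Fin N) :
    ∏ s, x s ^ moveExp e α i l s =
      (∏ s, x s ^ (α s - if s = i then e i else 0)) * x l ^ e l := by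
  have h : x l ^ e l = ∏ s, x s ^ (if s = l then e l else 0) := by simp
  rw [h, ← Finset.prod_mul_distrib]
  exact Finset.prod_congr rfl fun s _ => pow_add _ _ _

/-- A potential that increases when exponents are moved to larger coordinates. -/
def expPotential {N : ℕ} (w : Fin N → ℕ) (α : Fin N → ℕ) : ℕ :=
  ∑ i : Fin N, (i : ℕ) * (w i * α i)

theorem expPotential_le {N : ℕ} (w α : Fin N → ℕ) : expPotential w α ≤ N * expWeight w α := by
  rw [expPotential, expWeight, Finset.mul_sum]
  exact Finset.sum_le_sum fun i _ => Nat.mul_le_mul_right _ i.2.le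

theorem expPotential_lt_moveExp {N : ℕ} {e w : Fin N → ℕ} {D : ℕ} (hD0 : 0 < D)
    (hD : ∀ i, w i * e i = D) (α : Fin N → ℕ) {i l : Fin N} (hi : e i ≤ α i) (hil : i < l) :
    expPotential w α < expPotential w (moveExp e α i l) := by
  have h : ∀ s : Fin N, (s : ℕ) * (w s * moveExp e α i l s) + (if s = i then (i : ℕ) * D else 0)
      = s * (w s * α s) + if s = l then (l : ℕ) * D else 0 := by
    intro s
    have h1 : (α s - if s = i then e i else 0) + (if s = i then e i else 0) = α s := by
      split_ifs with h
      · subst h; omega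
      · omega
    have h2 : ∀ t : Fin N, (if s = t then (t : ℕ) * D else 0)
        = s * (w s * (if s = t then e t else 0)) := by
      intro t; split_ifs with h
      · subst h; rw [hD s]
      · simp
    rw [h2, h2, moveExp, ← mul_add, ← mul_add, ← mul_add, ← mul_add, add_right_comm, h1]
  have := Finset.sum_congr rfl fun s (_ : s ∈ Finset.univ) => h s
  rw [Finset.sum_add_distrib, Finset.sum_add_distrib] at this
  simp only [Finset.sum_ite_eq', Finset.mem_univ, if_true] at this
  have hlt : (i : ℕ) * D < l * D := Nat.mul_lt_mul_of_pos_right hil hD0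
  simp only [expPotential]
  omega

theorem mem_largeSet {N : ℕ} {e α : Fin N → ℕ} {i : Fin N} :
    i ∈ largeSet e α ↔ e i ≤ α i + 1 := by
  simp [largeSet]

theorem largeSet_moveExp {N : ℕ} (e α : Fin N → ℕ)
    {i l : Fin N} (hil : i ≠ l) :
    insert l ((largeSet e α).erase i) ⊆ largeSet e (moveExp e α i l) := by
  intro s hs
  rw [mem_largeSet, moveExp]
  rw [Finset.mem_insert, Finset.mem_erase, mem_largeSet] at hs
  rcases hs with rfl | ⟨h1, h2⟩
  · simp; omega
  · simp only [h1, if_false]; omega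

/-- Number of Lagrange points: the functions `λ_j(z) z^α` with `α` reduced span all functions
on the set of solutions. -/
theorem card_lagrange_le {N : ℕ} {κ : Type*} [Fintype κ] [DecidableEq κ]
    {e w : Fin N → ℕ} {D : ℕ} (hD0 : 0 < D) (hD : ∀ i, w i * e i = D)
    {c : Option κ → Fin N → ℝ} (hc : FullMinors c) (hc' : FullMinors fun j => c (some j))
    (hκ : Fintype.card κ ≤ N)
    {r : Option κ → MvPolynomial (Fin N) ℝ} (hr : ∀ j, LowWeight w D (r j))
    (Z : Finset (Fin N → ℝ))
    (hZ : ∀ x ∈ Z, ∀ j : κ, ∑ i, c (some j) i * x i ^ e i + MvPolynomial.eval x (r (some j)) = 0)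
    (hZ' : ∀ x ∈ Z, ∃ l : Option κ → ℝ, l none = 1 ∧ ∀ i, ∑ j, l j *
      (e i * c j i * x i ^ (e i - 1) + MvPolynomial.eval x (MvPolynomial.pderiv i (r j))) = 0) :
    Z.card ≤ (Fintype.card κ + 1) * (N.choose (Fintype.card κ) * ∏ i, e i) := by
  classical
  have he : ∀ i, 0 < e i := fun i => Nat.pos_of_ne_zero fun h => by
    have := hD i; rw [h] at this; omega
  set k := Fintype.card κ with hk
  have hex : ∀ z : Z, ∃ l : Option κ → ℝ, l none = 1 ∧ ∀ i, ∑ j, l j *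
      (e i * c j i * z.1 i ^ (e i - 1) +
        MvPolynomial.eval z.1 (MvPolynomial.pderiv i (r j))) = 0 := fun z => hZ' z z.2
  choose l hl0 hl using hex
  let F : (Fin N → ℕ) → Option κ → (Z → ℝ) := fun α j z => l z j * ∏ i, z.1 i ^ α i
  obtain ⟨hfin, hcard⟩ := reduced_finite_card e he hκ
  let G : Finset (Fin N → ℕ) := hfin.toFinset
  let gens : Finset (Z → ℝ) := (G ×ˢ (Finset.univ : Finset (Option κ))).image fun p => F p.1 p.2
  let W : Submodule ℝ (Z → ℝ) := Submodule.span ℝ (gens : Set (Z → ℝ))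
  have hgen : ∀ α, Reduced e k α → ∀ j, F α j ∈ W := fun α hα j =>
    Submodule.subset_span (Finset.mem_coe.2 (Finset.mem_image.2
      ⟨(α, j), by simpa [G] using hα, rfl⟩))
  -- products with polynomials all of whose monomials stay below the weight `d`
  have hpoly : ∀ d, (∀ β, expWeight w β < d → ∀ j, F β j ∈ W) → ∀ (α : Fin N → ℕ) (j)
      (q : MvPolynomial (Fin N) ℝ), (∀ β ∈ q.support, expWeight w α + expWeight w β < d) →
      (fun z : Z => l z j * (∏ i, z.1 i ^ α i) * MvPolynomial.eval z.1 q) ∈ W := by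
    intro d hd α j q hq
    have : (fun z : Z => l z j * (∏ i, z.1 i ^ α i) * MvPolynomial.eval z.1 q)
        = ∑ β ∈ q.support, q.coeff β • F (fun i => α i + β i) j := by
      funext z
      rw [MvPolynomial.eval_eq', Finset.mul_sum, Finset.sum_apply]
      refine Finset.sum_congr rfl fun β _ => ?_
      simp only [F, Pi.smul_apply, smul_eq_mul, pow_add, Finset.prod_mul_distrib]
      ring
    rw [this]
    refine Submodule.sum_mem _ fun β hβ => Submodule.smul_mem _ _ (hd _ ?_ j)
    have := hq β hβ
    simpa [expWeight, mul_add, Finset.sum_add_distrib] using this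
  have hsubst : ∀ α : Fin N → ℕ, (∀ β, expWeight w β < expWeight w α → ∀ j, F β j ∈ W) →
      ∀ (A' : Finset (Fin N)), A'.card = k → ∀ i ∈ A', e i ≤ α i →
      (∀ s, s ∉ A' → ∀ j, F (moveExp e α i s) j ∈ W) → ∀ j, F α j ∈ W := by
    intro α hlow A' hA' i hi hei hmove j
    obtain ⟨ν, hν⟩ := hc'.exists_row_comb hA' hi
    have key : F α j = - ∑ s ∈ A'ᶜ, (∑ j', ν j' * c (some j') s) • F (moveExp e α i s) j
        - ∑ j', ν j' • (fun z : Z => l z j * (∏ s, z.1 s ^ (α s - if s = i then e i else 0)) *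
            MvPolynomial.eval z.1 (r (some j'))) := by
      funext z
      have h0 : ∑ j', ν j' * (∑ s, c (some j') s * z.1 s ^ e s
          + MvPolynomial.eval z.1 (r (some j'))) = 0 :=
        Finset.sum_eq_zero fun j' _ => by rw [hZ z.1 z.2 j', mul_zero]
      have h1 : ∑ j', ν j' * (∑ s, c (some j') s * z.1 s ^ e s)
          = z.1 i ^ e i + ∑ s ∈ A'ᶜ, (∑ j', ν j' * c (some j') s) * z.1 s ^ e s := by
        have : ∑ j', ν j' * (∑ s, c (some j') s * z.1 s ^ e s)
            = ∑ s, (∑ j', ν j' * c (some j') s) * z.1 s ^ e s := by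
          simp only [Finset.mul_sum, Finset.sum_mul]
          rw [Finset.sum_comm]
          simp only [mul_assoc]
        rw [this, ← Finset.sum_add_sum_compl A']
        congr 1
        rw [Finset.sum_congr rfl fun s hs => by rw [hν s hs]]
        simp [hi]
      simp only [mul_add, Finset.sum_add_distrib] at h0
      rw [h1] at h0
      simp only [Pi.sub_apply, Pi.neg_apply, Finset.sum_apply, Pi.smul_apply, smul_eq_mul, F]
      rw [← prod_pow_sub z.1 α i hei]
      simp only [prod_pow_moveExp]
      have e1 : ∑ s ∈ A'ᶜ, (∑ j', ν j' * c (some j') s) *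
          (l z j * ((∏ s, z.1 s ^ (α s - if s = i then e i else 0)) * z.1 s ^ e s))
          = l z j * (∏ s, z.1 s ^ (α s - if s = i then e i else 0)) *
            ∑ s ∈ A'ᶜ, (∑ j', ν j' * c (some j') s) * z.1 s ^ e s := by
        rw [Finset.mul_sum]; exact Finset.sum_congr rfl fun s _ => by ring
      have e2 : ∑ j', ν j' * (l z j * (∏ s, z.1 s ^ (α s - if s = i then e i else 0)) *
            MvPolynomial.eval z.1 (r (some j')))
          = l z j * (∏ s, z.1 s ^ (α s - if s = i then e i else 0)) *
            ∑ j', ν j' * MvPolynomial.eval z.1 (r (some j')) := by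
        rw [Finset.mul_sum]; exact Finset.sum_congr rfl fun s _ => by ring
      rw [e1, e2]
      linear_combination l z j * (∏ s, z.1 s ^ (α s - if s = i then e i else 0)) * h0
    rw [key]
    refine Submodule.sub_mem _ (Submodule.neg_mem _ (Submodule.sum_mem _ fun s hs =>
      Submodule.smul_mem _ _ (hmove s (Finset.mem_compl.1 hs) j)))
      (Submodule.sum_mem _ fun j' _ => Submodule.smul_mem _ _ ?_)
    refine hpoly _ hlow _ _ _ fun β hβ => ?_
    have h1 := hr (some j') β hβ
    have h2 := expWeight_sub w α i hei
    have h3 := hD i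
    omega
  have hall : ∀ α j, F α j ∈ W := by
    intro α
    refine (InvImage.wf (fun α : Fin N → ℕ => toLex (expWeight w α,
      toLex (N - (largeSet e α).card, N * expWeight w α - expPotential w α)))
      wellFounded_lt).induction (C := fun α => ∀ j, F α j ∈ W) α ?_
    intro α ih
    have hlow : ∀ β, expWeight w β < expWeight w α → ∀ j, F β j ∈ W := fun β hβ =>
      ih β (Prod.Lex.toLex_lt_toLex.2 (Or.inl hβ))
    by_cases hA : k < (largeSet e α).card
    · -- the columns of `c` in a large enough set span
      intro j
      obtain ⟨B, hB, hBc⟩ := Finset.exists_subset_card_eq (Nat.succ_le_of_lt hA)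
      obtain ⟨μ, hμ⟩ := hc.exists_col_comb (B := B) (by simp [hBc, hk]) j
      have hei : ∀ i ∈ B, e i - 1 ≤ α i := fun i hi => by
        have := (Finset.mem_filter.1 (hB hi)).2; omega
      have key : F α j = ∑ i ∈ B, (- (μ i / e i)) • ∑ j', (fun z : Z => l z j' *
          (∏ s, z.1 s ^ (α s - if s = i then e i - 1 else 0)) *
            MvPolynomial.eval z.1 (MvPolynomial.pderiv i (r j'))) := by
        funext z
        simp only [Finset.sum_apply, Pi.smul_apply, smul_eq_mul, F]
        have h1 : l z j * ∏ s, z.1 s ^ α s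
            = ∑ i ∈ B, μ i * ∑ j', l z j' * c j' i * ∏ s, z.1 s ^ α s := by
          have : ∑ i ∈ B, μ i * ∑ j', l z j' * c j' i * ∏ s, z.1 s ^ α s
              = ∑ j', l z j' * (∏ s, z.1 s ^ α s) * ∑ i ∈ B, μ i * c j' i := by
            simp only [Finset.mul_sum]
            rw [Finset.sum_comm]
            exact Finset.sum_congr rfl fun _ _ => Finset.sum_congr rfl fun _ _ => by ring
          rw [this]
          simp [hμ]
        rw [h1]
        refine Finset.sum_congr rfl fun i hi => ?_
        have h2 := hl z i
        have hne : (e i : ℝ) ≠ 0 := by exact_mod_cast (he i).ne'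
        have h3 : ∑ j', l z j' * c j' i * ∏ s, z.1 s ^ α s
            = (∏ s, z.1 s ^ (α s - if s = i then e i - 1 else 0)) / e i *
              ∑ j', l z j' * (e i * c j' i * z.1 i ^ (e i - 1)) := by
          rw [← prod_pow_sub z.1 α i (hei i hi), Finset.mul_sum]
          exact Finset.sum_congr rfl fun _ _ => by field_simp
        have h4 : ∑ j', l z j' * (∏ s, z.1 s ^ (α s - if s = i then e i - 1 else 0)) *
            MvPolynomial.eval z.1 (MvPolynomial.pderiv i (r j'))
            = (∏ s, z.1 s ^ (α s - if s = i then e i - 1 else 0)) *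
              ∑ j', l z j' * MvPolynomial.eval z.1 (MvPolynomial.pderiv i (r j')) := by
          rw [Finset.mul_sum]; exact Finset.sum_congr rfl fun _ _ => by ring
        rw [h3, h4]
        simp only [mul_add, Finset.sum_add_distrib] at h2
        linear_combination (μ i * ((∏ s, z.1 s ^ (α s - if s = i then e i - 1 else 0)) / e i)) * h2
      rw [key]
      refine Submodule.sum_mem _ fun i hi => Submodule.smul_mem _ _
        (Submodule.sum_mem _ fun j' _ => ?_)
      refine hpoly _ hlow _ _ _ fun β hβ => ?_
      have h1 := (hr j').pderiv i hβ
      have h2 := expWeight_sub w α i (hei i hi)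
      have h3 := hD i
      obtain ⟨a, ha⟩ : ∃ a, e i = a + 1 := ⟨e i - 1, by have := he i; omega⟩
      rw [ha] at h2 h3 ⊢
      rw [mul_add] at h3
      simp only [Nat.add_sub_cancel] at h2 ⊢
      omega
    · by_cases hred : Reduced e k α
      · exact hgen α hred
      · rw [not_lt] at hA
        simp only [Reduced, hA, true_and, not_forall, not_and_or, not_lt]
          at hred
        obtain ⟨i, hi⟩ := hred
        have hei : e i ≤ α i := by
          rcases hi with hi | hi
          · have := he i; omega
          · exact hi.1
        have hiA : i ∈ largeSet e α := by simp [largeSet]; omega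
        rcases hi with hi | ⟨-, hi⟩
        · obtain ⟨A', hAA', -, hA'⟩ := Finset.exists_subsuperset_card_eq
            (Finset.subset_univ (largeSet e α)) hA (by simpa using hκ)
          refine hsubst α hlow A' hA' i (hAA' hiA) hei fun s hs => ih _ ?_
          have hsA : s ∉ largeSet e α := fun h => hs (hAA' h)
          have hsub : insert s (largeSet e α) ⊆ largeSet e (moveExp e α i s) := by
            have hne : i ≠ s := fun h => hs (h ▸ hAA' hiA)
            intro t ht
            by_cases hti : t = i
            · subst hti
              rw [mem_largeSet, moveExp, if_pos rfl, if_neg hne]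
              omega
            · apply largeSet_moveExp e α hne
              simpa [hti] using ht
          have h1 := Finset.card_le_card hsub
          rw [Finset.card_insert_of_notMem hsA] at h1
          have h2 := (Finset.card_le_univ (largeSet e (moveExp e α i s))).trans_eq
            (Fintype.card_fin N)
          refine Prod.Lex.toLex_lt_toLex.2 (Or.inr ⟨expWeight_moveExp hD α hei s,
            Prod.Lex.toLex_lt_toLex.2 (Or.inl ?_)⟩)
          dsimp only
          omega
        · have hcard' : (Finset.Iic i ∪ largeSet e α).card ≤ k := by
            rw [← Finset.sdiff_union_self_eq_union,
              Finset.card_union_of_disjoint Finset.sdiff_disjoint]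
            exact hi
          obtain ⟨A', hAA', -, hA'⟩ := Finset.exists_subsuperset_card_eq
            (Finset.subset_univ (Finset.Iic i ∪ largeSet e α)) hcard' (by simpa using hκ)
          refine hsubst α hlow A' hA' i (hAA' (Finset.mem_union_right _ hiA)) hei
            fun s hs => ih _ ?_
          have his : i < s := by
            by_contra h
            exact hs (hAA' (Finset.mem_union_left _ (Finset.mem_Iic.2 (not_lt.1 h))))
          have hsA : s ∉ largeSet e α := fun h => hs (hAA' (Finset.mem_union_right _ h))
          have h1 := Finset.card_le_card (largeSet_moveExp e α his.ne)
          rw [Finset.card_insert_of_notMem (fun h => hsA (Finset.mem_of_mem_erase h)),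
            Finset.card_erase_of_mem hiA] at h1
          have h2 := expPotential_lt_moveExp hD0 hD α hei his
          have h3 := expPotential_le w (moveExp e α i s)
          have h4 := expWeight_moveExp hD α hei s
          rw [h4] at h3
          have h5 := Finset.card_pos.2 ⟨i, hiA⟩
          refine Prod.Lex.toLex_lt_toLex.2 (Or.inr ⟨h4, Prod.Lex.toLex_lt_toLex.2 ?_⟩)
          rcases Nat.lt_or_ge (N - (largeSet e (moveExp e α i s)).card)
            (N - (largeSet e α).card) with h | h
          · exact Or.inl h
          · refine Or.inr ⟨?_, ?_⟩
            · dsimp only; omega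
            · dsimp only; rw [h4]; omega
  have htop : W = ⊤ := by
    rw [eq_top_iff, ← (Pi.basisFun ℝ Z).span_eq, Submodule.span_le]
    rintro _ ⟨z, rfl⟩
    have hsep : ∀ y : Z, ∃ f : MvPolynomial (Fin N) ℝ, y ≠ z →
        MvPolynomial.eval y.1 f = 0 ∧ MvPolynomial.eval z.1 f = 1 := by
      intro y
      by_cases h : y = z
      · exact ⟨0, fun h' => (h' h).elim⟩
      · obtain ⟨i, hi⟩ := Function.ne_iff.1 (fun h' => h (Subtype.ext h'))
        refine ⟨MvPolynomial.C (z.1 i - y.1 i)⁻¹ *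
          (MvPolynomial.X i - MvPolynomial.C (y.1 i)), fun _ => ⟨by simp, ?_⟩⟩
        simpa using inv_mul_cancel₀ (sub_ne_zero.2 (Ne.symm hi))
    choose f hf using hsep
    let q : MvPolynomial (Fin N) ℝ := ∏ y ∈ Finset.univ.erase z, f y
    have hq : Pi.basisFun ℝ Z z = fun y : Z => l y none * (∏ i, y.1 i ^ (0 : Fin N → ℕ) i)
        * MvPolynomial.eval y.1 q := by
      funext y
      simp only [hl0, q, Pi.zero_apply, pow_zero, Finset.prod_const_one, one_mul, map_prod,
        Pi.basisFun_apply]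
      by_cases h : y = z
      · subst h
        rw [Pi.single_eq_same, Finset.prod_eq_one]
        exact fun y' hy' => (hf y' (Finset.ne_of_mem_erase hy')).2
      · rw [Pi.single_eq_of_ne h, Finset.prod_eq_zero (Finset.mem_erase.2 ⟨h, Finset.mem_univ y⟩)]
        exact (hf y h).1
    rw [hq]
    exact hpoly (expWeight w 0 + q.support.sup (fun β => expWeight w β) + 1)
      (fun β _ j => hall β j) _ _ _ fun β hβ => by
        have := Finset.le_sup (f := fun β : Fin N →₀ ℕ => expWeight w β) hβ
        omega
  have h1 : Module.finrank ℝ W = Z.card := by rw [htop]; simp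
  have h2 : Module.finrank ℝ W ≤ gens.card := finrank_span_finset_le_card gens
  have h3 : gens.card ≤ G.card * (k + 1) := by
    refine Finset.card_image_le.trans ?_
    simp [Finset.card_product, hk]
  have h4 : G.card ≤ N.choose k * ∏ i, e i := by
    rw [← Set.ncard_eq_toFinset_card _ hfin]; exact hcard
  rw [← h1]
  refine h2.trans (h3.trans ?_)
  rw [mul_comm]
  exact Nat.mul_le_mul_left _ h4

theorem hasDerivAt_eval_line {N : ℕ} (p : MvPolynomial (Fin N) ℝ) (x v : Fin N → ℝ) :
    HasDerivAt (fun t : ℝ => MvPolynomial.eval (x + t • v) p)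
      (∑ i, MvPolynomial.eval x (MvPolynomial.pderiv i p) * v i) 0 := by
  induction p using MvPolynomial.induction_on with
  | C a => simpa using hasDerivAt_const (0 : ℝ) a
  | add p q hp hq =>
    simpa [add_mul, Finset.sum_add_distrib, Pi.add_def] using hp.add hq
  | mul_X p i hp =>
    have hX : HasDerivAt (fun t : ℝ => x i + t * v i) (v i) 0 := by
      simpa using ((hasDerivAt_id (0 : ℝ)).mul_const (v i)).const_add (x i)
    have h := hp.mul hX
    simp only [Pi.mul_def, zero_smul, add_zero, zero_mul] at h
    simp only [map_mul, MvPolynomial.eval_X, Pi.add_apply, Pi.smul_apply, smul_eq_mul]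
    refine h.congr_deriv ?_
    simp only [Derivation.leibniz, smul_eq_mul, map_add, map_mul, MvPolynomial.eval_X,
      MvPolynomial.pderiv_X, add_mul, Finset.sum_add_distrib]
    have h1 : ∑ j, MvPolynomial.eval x p *
        MvPolynomial.eval x (Pi.single (M := fun _ : Fin N => MvPolynomial (Fin N) ℝ) j 1 i) * v j
        = MvPolynomial.eval x p * v i := by
      rw [Finset.sum_eq_single i]
      · simp
      · intro j _ hj; simp [hj.symm]
      · simp
    rw [h1, add_comm, Finset.sum_mul]
    congr 1
    exact Finset.sum_congr rfl fun j _ => by ring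

theorem HasDerivAt.eventually_lt_of_pos {f : ℝ → ℝ} {f' : ℝ} (h : HasDerivAt f f' 0)
    (hf' : 0 < f') : ∀ᶠ t in nhdsWithin 0 (Set.Ioi 0), f 0 < f t := by
  have h1 := (hasDerivAt_iff_tendsto_slope.1 h).eventually (lt_mem_nhds hf')
  have h2 := h1.filter_mono (nhdsWithin_mono 0
    (fun t (ht : t ∈ Set.Ioi (0 : ℝ)) => (ne_of_gt ht : t ≠ 0)))
  filter_upwards [h2, self_mem_nhdsWithin] with t ht ht0
  rw [slope_def_field, sub_zero] at ht
  have := (div_pos_iff_of_pos_right (show (0 : ℝ) < t from ht0)).1 ht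
  linarith

theorem exists_dotProduct_eq {N : ℕ} {ι : Type*} {g : ι → Fin N → ℝ}
    (hg : LinearIndependent ℝ g) (t : ι → ℝ) : ∃ v : Fin N → ℝ, ∀ a, ∑ i, g a i * v i = t a := by
  obtain ⟨f, hf⟩ := LinearMap.exists_leftInverse_of_injective
    (Finsupp.linearCombination ℝ g) (LinearMap.ker_eq_bot.2 hg)
  let φ : (Fin N → ℝ) →ₗ[ℝ] ℝ := (Finsupp.linearCombination ℝ t).comp f
  refine ⟨fun i => φ (Pi.single i 1), fun a => ?_⟩
  have h1 : φ (g a) = t a := by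
    have := LinearMap.congr_fun hf (Finsupp.single a 1)
    simp only [LinearMap.comp_apply, Finsupp.linearCombination_single, one_smul,
      LinearMap.id_apply] at this
    simp [φ, this]
  rw [← h1, LinearMap.pi_apply_eq_sum_univ φ (g a)]
  refine Finset.sum_congr rfl fun i _ => ?_
  rw [smul_eq_mul]
  congr 1
  refine congrArg φ (funext fun j => ?_)
  simp [Pi.single_apply, eq_comm]

/-- The gradient of a polynomial at a point. -/
def polyGrad {N : ℕ} (p : MvPolynomial (Fin N) ℝ) (x : Fin N → ℝ) : Fin N → ℝ :=
  fun i => MvPolynomial.eval x (MvPolynomial.pderiv i p)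

theorem exists_small_span {N : ℕ} {J : Type*} [Fintype J] [DecidableEq J] (g : J → Fin N → ℝ)
    (A : Finset J) {y : Fin N → ℝ} (hy : y ∈ Submodule.span ℝ (g '' A)) :
    ∃ B ⊆ A, B.card ≤ N ∧ y ∈ Submodule.span ℝ (g '' B) := by
  obtain ⟨κ, a, ha, hs, hli⟩ := exists_linearIndependent' ℝ (fun j : A => g j)
  have : Finite κ := Finite.of_injective a ha
  have := Fintype.ofFinite κ
  refine ⟨Finset.univ.image fun k => (a k : J), ?_, ?_, ?_⟩
  · intro j hj
    obtain ⟨k, -, rfl⟩ := Finset.mem_image.1 hj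
    exact (a k).2
  · refine Finset.card_image_le.trans ?_
    simpa using hli.fintype_card_le_finrank
  · have h1 : g '' A = Set.range (fun j : A => g j) := by
      ext; simp
    rw [h1, ← hs] at hy
    have h2 : g '' (Finset.univ.image fun k => (a k : J) : Finset J)
        = Set.range ((fun j : A => g j) ∘ a) := by
      ext; simp
    rwa [h2]

/-- First-order conditions for a constrained minimum. -/
theorem exists_gradient_relation {N : ℕ} {J : Type*} [Fintype J] [DecidableEq J]
    (P : Option J → MvPolynomial (Fin N) ℝ) (s : J → ℝ) (x : Fin N → ℝ)
    (hx : ∀ j, 1 ≤ s j * MvPolynomial.eval x (P (some j)))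
    (hmin : ∀ y, (∀ j, 1 ≤ s j * MvPolynomial.eval y (P (some j))) →
      MvPolynomial.eval x (P none) ≤ MvPolynomial.eval y (P none)) :
    ∃ (B : Finset J) (j₀ : Option J), B.card ≤ N ∧ (∀ j ∈ B, some j ≠ j₀) ∧
      (∀ j ∈ B, s j * MvPolynomial.eval x (P (some j)) = 1) ∧
      polyGrad (P j₀) x ∈ Submodule.span ℝ ((fun j => polyGrad (P (some j)) x) '' B) := by
  classical
  let A : Finset J := Finset.univ.filter fun j => s j * MvPolynomial.eval x (P (some j)) = 1
  have hA : ∀ j ∈ A, s j * MvPolynomial.eval x (P (some j)) = 1 := fun j hj =>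
    (Finset.mem_filter.1 hj).2
  have hs0 : ∀ j, s j ≠ 0 := fun j h => by have := hx j; rw [h] at this; norm_num at this
  by_cases hnone : polyGrad (P none) x ∈ Submodule.span ℝ ((fun j => polyGrad (P (some j)) x) '' A)
  · obtain ⟨B, hBA, hB, h⟩ := exists_small_span _ A hnone
    exact ⟨B, none, hB, fun _ _ => by simp, fun j hj => hA j (hBA hj), h⟩
  by_cases hli : LinearIndependent ℝ fun j : A => polyGrad (P (some j)) x
  · exfalso
    have hli' : LinearIndependent ℝ (fun o : Option A => polyGrad (P (o.map Subtype.val)) x) := by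
      rw [linearIndependent_option]
      refine ⟨hli, fun h => hnone ?_⟩
      have h1 : (fun j => polyGrad (P (some j)) x) '' (A : Set J)
          = Set.range fun j : A => polyGrad (P (some j)) x := by
        ext; simp
      rw [h1]
      exact h
    obtain ⟨v, hv⟩ := exists_dotProduct_eq hli' fun o => o.elim (-1) fun j => s j
    have hder : ∀ o : Option A, HasDerivAt
        (fun t : ℝ => MvPolynomial.eval (x + t • v) (P (o.map Subtype.val)))
        (o.elim (-1) fun j => s j) 0 := fun o => by
      have := hasDerivAt_eval_line (P (o.map Subtype.val)) x v
      rwa [show ∑ i, MvPolynomial.eval x (MvPolynomial.pderiv i (P (o.map Subtype.val))) * v i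
        = _ from hv o] at this
    have hdec : ∀ᶠ t : ℝ in nhdsWithin 0 (Set.Ioi 0),
        MvPolynomial.eval (x + t • v) (P none) < MvPolynomial.eval x (P none) := by
      have h := (hder none).neg.eventually_lt_of_pos (by simp)
      simpa using h
    have hinc : ∀ᶠ t : ℝ in nhdsWithin 0 (Set.Ioi 0), ∀ j,
        1 ≤ s j * MvPolynomial.eval (x + t • v) (P (some j)) := by
      rw [Filter.eventually_all]
      intro j
      by_cases hj : j ∈ A
      · have h := ((hder (some ⟨j, hj⟩)).const_mul (s j)).eventually_lt_of_pos
          (mul_self_pos.2 (hs0 j))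
        refine h.mono fun t ht => ?_
        have h1 := hA j hj
        simp only [zero_smul, add_zero, Option.map_some, h1] at ht
        exact ht.le
      · have hc : ContinuousAt (fun t : ℝ => s j * MvPolynomial.eval (x + t • v) (P (some j))) 0 :=
          ((hasDerivAt_eval_line (P (some j)) x v).const_mul (s j)).continuousAt
        have hlt : 1 < s j * MvPolynomial.eval (x + (0 : ℝ) • v) (P (some j)) := by
          rw [zero_smul, add_zero]
          exact lt_of_le_of_ne (hx j) fun h => hj (Finset.mem_filter.2 ⟨Finset.mem_univ _, h.symm⟩)
        exact ((hc.eventually (lt_mem_nhds hlt)).filter_mono nhdsWithin_le_nhds).mono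
          fun t ht => ht.le
    obtain ⟨t, h1, h2⟩ := (hdec.and hinc).exists
    exact absurd (hmin _ h2) (not_le.2 h1)
  · rw [linearIndependent_iff_notMem_span] at hli
    push Not at hli
    obtain ⟨j₀, hj₀⟩ := hli
    have hj₀' : polyGrad (P (some j₀)) x ∈
        Submodule.span ℝ ((fun j => polyGrad (P (some j)) x) '' (A.erase j₀ : Finset J)) := by
      refine Submodule.span_mono ?_ hj₀
      rintro _ ⟨j, hj, rfl⟩
      refine ⟨j, ?_, rfl⟩
      simp only [Finset.coe_erase, Set.mem_sdiff, Finset.mem_coe, Finset.coe_mem, true_and,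
        Set.mem_singleton_iff] at hj ⊢
      exact fun h => hj.2 (Subtype.ext h)
    obtain ⟨B, hBA, hB, h⟩ := exists_small_span _ _ hj₀'
    refine ⟨B, some j₀, hB, fun j hj h => ?_,
      fun j hj => hA j (Finset.mem_of_mem_erase (hBA hj)), h⟩
    exact Finset.ne_of_mem_erase (hBA hj) (Option.some_injective _ h)

theorem LowWeight.C_mul {N : ℕ} {w : Fin N → ℕ} {D : ℕ} {r : MvPolynomial (Fin N) ℝ}
    (hr : LowWeight w D r) (t : ℝ) : LowWeight w D (MvPolynomial.C t * r) := by
  intro β hβ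
  apply hr
  rw [MvPolynomial.mem_support_iff, MvPolynomial.coeff_C_mul] at hβ
  exact MvPolynomial.mem_support_iff.2 (right_ne_zero_of_mul hβ)

theorem lowWeight_C {N : ℕ} (w : Fin N → ℕ) {D : ℕ} (hD : 0 < D) (t : ℝ) :
    LowWeight w D (MvPolynomial.C t) := by
  intro β hβ
  have : β = 0 := by
    by_contra h
    rw [MvPolynomial.mem_support_iff, MvPolynomial.coeff_C, if_neg (Ne.symm h)] at hβ
    exact hβ rfl
  simpa [this, expWeight] using hD

theorem LowWeight.add {N : ℕ} {w : Fin N → ℕ} {D : ℕ} {p q : MvPolynomial (Fin N) ℝ}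
    (hp : LowWeight w D p) (hq : LowWeight w D q) : LowWeight w D (p + q) := by
  intro β hβ
  rcases Finset.mem_union.1 (MvPolynomial.support_add hβ) with h | h
  · exact hp β h
  · exact hq β h

theorem exists_isMin_sum_even_pow {N : ℕ} {e : Fin N → ℕ} (he : ∀ i, 0 < e i)
    (heven : ∀ i, Even (e i)) {c : Fin N → ℝ} (hc : ∀ i, 0 < c i) {K : Set (Fin N → ℝ)}
    (hK : IsClosed K) (hne : K.Nonempty) :
    ∃ x ∈ K, ∀ y ∈ K, ∑ i, c i * x i ^ e i ≤ ∑ i, c i * y i ^ e i := by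
  obtain ⟨q, hq⟩ := hne
  set φ : (Fin N → ℝ) → ℝ := fun x => ∑ i, c i * x i ^ e i with hφ
  have hcont : Continuous φ := by fun_prop
  have hterm : ∀ (x : Fin N → ℝ) (i), 0 ≤ c i * x i ^ e i := fun x i =>
    mul_nonneg (hc i).le ((heven i).pow_nonneg _)
  let R : ℝ := 1 + ∑ i, φ q / c i
  have hφq : 0 ≤ φ q := Finset.sum_nonneg fun i _ => hterm q i
  have hsub : K ∩ {x | φ x ≤ φ q} ⊆ Set.Icc (fun _ => -R) (fun _ => R) := by
    rintro x ⟨-, hx⟩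
    have hb : ∀ i, |x i| ≤ R := by
      intro i
      have h1 : c i * x i ^ e i ≤ φ q :=
        (Finset.single_le_sum (fun i _ => hterm x i) (Finset.mem_univ i)).trans hx
      have h2 : φ q / c i ≤ ∑ i, φ q / c i :=
        Finset.single_le_sum (f := fun i => φ q / c i)
          (fun i _ => div_nonneg hφq (hc i).le) (Finset.mem_univ i)
      have h0 : 0 ≤ φ q / c i := div_nonneg hφq (hc i).le
      by_cases h : |x i| ≤ 1
      · simp only [R]; linarith
      · have h3 : |x i| ≤ |x i| ^ e i := le_self_pow₀ (not_le.1 h).le (he i).ne'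
        rw [(heven i).pow_abs] at h3
        have h4 : x i ^ e i ≤ φ q / c i := by
          rw [le_div_iff₀ (hc i), mul_comm]; exact h1
        simp only [R]; linarith
    exact ⟨fun i => (abs_le.1 (hb i)).1, fun i => (abs_le.1 (hb i)).2⟩
  have hcomp : IsCompact (K ∩ {x | φ x ≤ φ q}) :=
    isCompact_Icc.of_isClosed_subset (hK.inter (isClosed_le hcont continuous_const)) hsub
  obtain ⟨x, hx, hmin⟩ := hcomp.exists_isMinOn ⟨q, hq, le_refl (φ q)⟩ hcont.continuousOn
  refine ⟨x, hx.1, fun y hy => ?_⟩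
  by_cases h : φ y ≤ φ q
  · exact hmin ⟨hy, h⟩
  · exact hx.2.trans (not_le.1 h).le

/-- The real number `1` or `-1` attached to a Boolean. -/
def boolSign (b : Bool) : ℝ := if b then 1 else -1

theorem boolSign_mul_self (b : Bool) : boolSign b * boolSign b = 1 := by
  cases b <;> simp [boolSign]

theorem eq_of_boolSign_mul_pos {a b : Bool} {t : ℝ} (ha : 0 < boolSign a * t)
    (hb : 0 < boolSign b * t) : a = b := by
  cases a <;> cases b <;> simp [boolSign] at ha hb ⊢ <;> linarith

theorem sum_choose_card_mul_two_pow_le (J : Type*) [Fintype J] [DecidableEq J] (N E : ℕ) :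
    ∑ B : Finset J, 2 ^ B.card * ((Fintype.card J + 1) * ((B.card + 1) * (N.choose B.card * E)))
      ≤ (Fintype.card J + 1) * ((N + 1) *
        (2 ^ N * ((Fintype.card J + N).choose N * E))) := by
  set m := Fintype.card J
  have h1 : ∀ B : Finset J, 2 ^ B.card * ((m + 1) * ((B.card + 1) * (N.choose B.card * E)))
      ≤ (m + 1) * ((N + 1) * (2 ^ N * E)) * N.choose B.card := by
    intro B
    by_cases h : B.card ≤ N
    · calc 2 ^ B.card * ((m + 1) * ((B.card + 1) * (N.choose B.card * E)))
          = (m + 1) * ((B.card + 1) * (2 ^ B.card * E)) * N.choose B.card := by ring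
        _ ≤ _ := by gcongr; norm_num
    · simp [Nat.choose_eq_zero_of_lt (not_le.1 h)]
  refine (Finset.sum_le_sum fun B _ => h1 B).trans ?_
  rw [← Finset.mul_sum]
  have h2 : ∑ B : Finset J, N.choose B.card ≤ (m + N).choose N := by
    rw [← Finset.powerset_univ, Finset.sum_powerset_apply_card (fun k => N.choose k),
      Nat.add_choose_eq]
    simp only [smul_eq_mul, Finset.card_univ]
    rw [Finset.Nat.sum_antidiagonal_eq_sum_range_succ (fun i j => m.choose i * N.choose j)]
    have h3 : ∀ k ∈ Finset.range (N + 1), m.choose k * N.choose (N - k)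
        = m.choose k * N.choose k := fun k hk => by
      rw [Nat.choose_symm (Nat.lt_succ_iff.1 (Finset.mem_range.1 hk))]
    rw [Finset.sum_congr rfl h3]
    refine Finset.sum_le_sum_of_ne_zero fun k hk hne => ?_
    rw [Finset.mem_range]
    by_contra h
    exact hne (by rw [Nat.choose_eq_zero_of_lt (by omega : N < k), mul_zero])
  calc _ ≤ (m + 1) * ((N + 1) * (2 ^ N * E)) * (m + N).choose N := by gcongr
    _ = _ := by ring

/-- A Milnor–Thom–Warren type bound for the number of strict sign patterns. -/
theorem card_signPatterns_le {N : ℕ} {J : Type*} [Fintype J] [DecidableEq J]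
    {e w : Fin N → ℕ} {D : ℕ} (hD0 : 0 < D) (hD : ∀ i, w i * e i = D) (heven : ∀ i, Even (e i))
    {p : J → MvPolynomial (Fin N) ℝ} (hp : ∀ j, LowWeight w D (p j)) (S : Finset (J → Bool))
    (hS : ∀ s ∈ S, ∃ x, ∀ j, 0 < boolSign (s j) * MvPolynomial.eval x (p j)) :
    S.card ≤ (Fintype.card J + 1) * ((N + 1) *
      (2 ^ N * ((Fintype.card J + N).choose N * ∏ i, e i))) := by
  classical
  have he : ∀ i, 0 < e i := fun i => Nat.pos_of_ne_zero fun h => by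
    have := hD i; rw [h] at this; omega
  -- a totally nonsingular positive matrix of coefficients
  let a : Option J → ℝ := fun j => (Fintype.equivFin (Option J) j : ℕ) + 1
  let c : Option J → Fin N → ℝ := fun j i => (a j + (i : ℕ))⁻¹
  have ha : Function.Injective a := fun j j' h => by
    simpa [a, Fin.val_inj] using h
  have hpos : ∀ j i, 0 < a j + ((i : Fin N) : ℕ) := fun j i => by positivity
  have hc0 : ∀ j i, 0 < c j i := fun j i => inv_pos.2 (hpos j i)
  have hminors : ∀ {κ : Type _} [Fintype κ] [DecidableEq κ] (f : κ → Option J),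
      Function.Injective f → FullMinors fun k => c (f k) := fun f hf g hg =>
    cauchy_det_ne_zero (fun k => a (f k)) (fun k => ((g k : Fin N) : ℕ)) (ha.comp hf)
      (fun k k' h => hg (by simpa [Fin.val_inj] using h)) fun k k' => (hpos _ _).ne'
  let L : Option J → MvPolynomial (Fin N) ℝ := fun j =>
    ∑ i, MvPolynomial.C (c j i) * MvPolynomial.X i ^ e i
  have hL : ∀ j x, MvPolynomial.eval x (L j) = ∑ i, c j i * x i ^ e i := fun j x => by simp [L]
  have hLd : ∀ j x i, MvPolynomial.eval x (MvPolynomial.pderiv i (L j))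
      = e i * c j i * x i ^ (e i - 1) := fun j x i => by
    simp only [L, map_sum, Derivation.leibniz, MvPolynomial.pderiv_C,
      Derivation.leibniz_pow, MvPolynomial.pderiv_X, smul_eq_mul]
    rw [Finset.sum_eq_single i]
    · simp; ring
    · intro i' _ hi'; simp [hi'.symm]
    · simp
  choose! q hq using hS
  -- scale so that all witnesses satisfy the perturbed inequalities with margin one
  obtain ⟨θ, hθ⟩ : ∃ θ : ℝ, ∀ s : S, ∀ j, 1 ≤ boolSign (s.1 j) *
      (θ * MvPolynomial.eval (q s) (p j) + MvPolynomial.eval (q s) (L (some j))) := by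
    have : ∀ᶠ θ : ℝ in Filter.atTop, ∀ s : S, ∀ j, 1 ≤ boolSign (s.1 j) *
        (θ * MvPolynomial.eval (q s) (p j) + MvPolynomial.eval (q s) (L (some j))) := by
      refine Filter.eventually_all.2 fun s => Filter.eventually_all.2 fun j => ?_
      have hpos := hq s.1 s.2 j
      have ht := (Filter.tendsto_id.atTop_mul_const hpos).eventually_ge_atTop
        (1 - boolSign (s.1 j) * MvPolynomial.eval (q s) (L (some j)))
      filter_upwards [ht] with θ hθ
      simp only [id] at hθ
      linarith
    exact this.exists
  let p' : Option J → MvPolynomial (Fin N) ℝ := fun j => j.elim 0 p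
  have hp' : ∀ j, LowWeight w D (p' j) := fun j => by
    cases j with
    | none => intro β hβ; simp [p'] at hβ
    | some j => exact hp j
  let P : Option J → MvPolynomial (Fin N) ℝ := fun j => MvPolynomial.C θ * p' j + L j
  have hPe : ∀ j x, MvPolynomial.eval x (P j)
      = θ * MvPolynomial.eval x (p' j) + MvPolynomial.eval x (L j) := fun j x => by simp [P]
  have hex : ∀ s : S, ∃ (x : Fin N → ℝ) (B : Finset J) (j₀ : Option J),
      (∀ j, 1 ≤ boolSign (s.1 j) * MvPolynomial.eval x (P (some j))) ∧ B.card ≤ N ∧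
      (∀ j ∈ B, some j ≠ j₀) ∧
      (∀ j ∈ B, boolSign (s.1 j) * MvPolynomial.eval x (P (some j)) = 1) ∧
      polyGrad (P j₀) x ∈ Submodule.span ℝ ((fun j => polyGrad (P (some j)) x) '' B) := by
    intro s
    obtain ⟨x, hx, hmin⟩ := exists_isMin_sum_even_pow he heven (hc0 none)
      (K := {x | ∀ j, 1 ≤ boolSign (s.1 j) * MvPolynomial.eval x (P (some j))})
      (by
        simp only [Set.ofPred_forall]
        exact isClosed_iInter fun j => isClosed_le continuous_const
          (continuous_const.mul (MvPolynomial.continuous_eval _)))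
      ⟨q s, fun j => by rw [hPe]; exact hθ s j⟩
    obtain ⟨B, j₀, h⟩ := exists_gradient_relation P (fun j => boolSign (s.1 j)) x hx
      (fun y hy => by simpa [hPe, hL, p'] using hmin y hy)
    exact ⟨x, B, j₀, hx, h⟩
  choose x B j₀ hx hB hBj hBact hgrad using hex
  have hxinj : Function.Injective x := fun s s' h => by
    apply Subtype.ext
    funext j
    have h1 := hx s j
    have h2 := hx s' j
    rw [← h] at h2
    exact eq_of_boolSign_mul_pos (zero_lt_one.trans_le h1) (zero_lt_one.trans_le h2)
  -- the combinatorial type of a minimizer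
  let Φ : S → (_ : Finset J) × Finset J × Option J := fun s =>
    ⟨B s, (B s).filter (fun j => s.1 j = true), j₀ s⟩
  let T : Finset ((_ : Finset J) × Finset J × Option J) :=
    Finset.univ.sigma fun B => B.powerset ×ˢ Finset.univ
  have hfiber : ∀ d ∈ T, (Finset.univ.filter fun s => Φ s = d).card
      ≤ (d.1.card + 1) * (N.choose d.1.card * ∏ i, e i) := by
    rintro ⟨A, τ, o⟩ -
    rcases (Finset.univ.filter fun s => Φ s = ⟨A, τ, o⟩).eq_empty_or_nonempty with h0 | ⟨s₀, hs₀⟩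
    · rw [h0]; simp
    have hΦ : ∀ s, Φ s = ⟨A, τ, o⟩ ↔ B s = A ∧ (B s).filter (fun j => s.1 j = true) = τ ∧
        j₀ s = o := fun s => by simp [Φ]
    obtain ⟨hA0, -, ho0⟩ := (hΦ s₀).1 (Finset.mem_filter.1 hs₀).2
    let f : Option A → Option J := fun k => k.elim o fun j => some j.1
    have hf : Function.Injective f := by
      intro k k' h
      have hne : ∀ j : A, some j.1 ≠ o := fun j => ho0 ▸ hBj s₀ j (hA0 ▸ j.2)
      cases k with
      | none => cases k' with
        | none => rfl
        | some k' => exact (hne k' h.symm).elim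
      | some k => cases k' with
        | none => exact (hne k h).elim
        | some k' => exact congrArg some (Subtype.ext (Option.some_injective _ h))
    let r : Option A → MvPolynomial (Fin N) ℝ := fun k => MvPolynomial.C θ * p' (f k) +
      MvPolynomial.C (k.elim 0 fun j => - boolSign (decide (j.1 ∈ τ)))
    have hrd : ∀ k x i, MvPolynomial.eval x (MvPolynomial.pderiv i (r k))
        = MvPolynomial.eval x (MvPolynomial.pderiv i (MvPolynomial.C θ * p' (f k))) := by
      intro k x i; simp only [r, map_add, MvPolynomial.pderiv_C, add_zero]
    have hgr : ∀ k x i, polyGrad (P (f k)) x i = e i * c (f k) i * x i ^ (e i - 1) +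
        MvPolynomial.eval x (MvPolynomial.pderiv i (r k)) := by
      intro k x i
      rw [hrd, ← hLd, add_comm]
      simp only [polyGrad, P, map_add]
    have key := card_lagrange_le hD0 hD (c := fun k => c (f k)) (hminors f hf)
      (hminors (fun j : A => f (some j)) (hf.comp (Option.some_injective _)))
      (by simpa [← hA0] using hB s₀) (r := r)
      (fun k => ((hp' _).C_mul θ).add (lowWeight_C w hD0 _))
      ((Finset.univ.filter fun s => Φ s = ⟨A, τ, o⟩).image x)
      (by
        intro y hy j
        obtain ⟨s, hs, rfl⟩ := Finset.mem_image.1 hy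
        obtain ⟨hA, hτ, -⟩ := (hΦ s).1 (Finset.mem_filter.1 hs).2
        have h1 := hBact s j (hA ▸ j.2)
        have h2 : decide (j.1 ∈ τ) = s.1 j.1 := by
          rw [← hτ, hA]; simp
        have h3 := congrArg (boolSign (s.1 j.1) * ·) h1
        simp only [← mul_assoc, boolSign_mul_self, one_mul, mul_one] at h3
        rw [hPe, hL] at h3
        simp only [r, f, Option.elim, map_add, map_mul, MvPolynomial.eval_C, h2]
        linarith)
      (by
        intro y hy
        obtain ⟨s, hs, rfl⟩ := Finset.mem_image.1 hy
        obtain ⟨hA, -, ho⟩ := (hΦ s).1 (Finset.mem_filter.1 hs).2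
        have h1 := hgrad s
        rw [hA, ho] at h1
        have h2 : (fun j => polyGrad (P (some j)) (x s)) '' (A : Set J)
            = Set.range fun j : A => polyGrad (P (some j)) (x s) := by
          ext; simp
        rw [h2, Submodule.mem_span_range_iff_exists_fun] at h1
        obtain ⟨l, hl⟩ := h1
        refine ⟨fun k => k.elim 1 fun j => - l j, rfl, fun i => ?_⟩
        simp only [← hgr]
        rw [Fintype.sum_option]
        have h3 := congrFun hl i
        simp only [Finset.sum_apply, Pi.smul_apply, smul_eq_mul] at h3
        simp only [Option.elim, f, one_mul, neg_mul, Finset.sum_neg_distrib]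
        linarith)
    rw [Finset.card_image_of_injective _ hxinj, Fintype.card_coe] at key
    exact key
  have hmaps : ∀ s ∈ (Finset.univ : Finset S), Φ s ∈ T := fun s _ => by
    simp [T, Φ]
  have hcard := Finset.card_eq_sum_card_fiberwise hmaps
  rw [Finset.card_univ, Fintype.card_coe] at hcard
  rw [hcard]
  refine (Finset.sum_le_sum hfiber).trans ?_
  refine le_trans (le_of_eq ?_) (sum_choose_card_mul_two_pow_le J N (∏ i, e i))
  rw [Finset.sum_sigma]
  refine Finset.sum_congr rfl fun A _ => ?_
  simp only [Finset.sum_const, Finset.card_product, Finset.card_powerset, Finset.card_univ,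
    Fintype.card_option, smul_eq_mul]
  ring

theorem LowWeight.mul {N : ℕ} {w : Fin N → ℕ} {a b : ℕ} {p q : MvPolynomial (Fin N) ℝ}
    (hp : LowWeight w (a + 1) p) (hq : LowWeight w (b + 1) q) :
    LowWeight w (a + b + 1) (p * q) := by
  classical
  intro β hβ
  obtain ⟨β₁, h₁, β₂, h₂, rfl⟩ := Finset.mem_add.1 (MvPolynomial.support_mul p q hβ)
  have h1 := hp β₁ h₁
  have h2 := hq β₂ h₂
  have : expWeight w (β₁ + β₂ : Fin N →₀ ℕ) = expWeight w β₁ + expWeight w β₂ := by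
    simp [expWeight, mul_add, Finset.sum_add_distrib]
  omega

theorem LowWeight.sub {N : ℕ} {w : Fin N → ℕ} {D : ℕ} {p q : MvPolynomial (Fin N) ℝ}
    (hp : LowWeight w D p) (hq : LowWeight w D q) : LowWeight w D (p - q) := by
  have h : p - q = p + MvPolynomial.C (-1) * q := by simp [sub_eq_add_neg]
  rw [h]
  exact hp.add (hq.C_mul _)

theorem lowWeight_X {N : ℕ} (w : Fin N → ℕ) (i : Fin N) :
    LowWeight w (w i + 1) (MvPolynomial.X i) := by
  intro β hβ
  rw [MvPolynomial.support_X, Finset.mem_singleton] at hβ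
  simp [hβ, expWeight, Finsupp.single_apply]

/-- Twice the signed area of the triangle `abc`. -/
def orient (a b c : Plane) : ℝ := (b 0 - a 0) * (c 1 - a 1) - (b 1 - a 1) * (c 0 - a 0)

theorem orient_rotate (a b c : Plane) : orient b c a = orient a b c := by
  simp only [orient]; ring

theorem orient_swap (a b c : Plane) : orient b a c = - orient a b c := by
  simp only [orient]; ring

/-- The three-element subsets of the index set. -/
abbrev Triple (n : ℕ) := {s : Finset (Fin n) // s.card = 3}

/-- A fixed enumeration of a three-element set. -/
def Triple.pt {n : ℕ} (s : Triple n) (i : Fin 3) : Fin n :=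
  ((Finset.equivFinOfCardEq s.2).symm i : s.1)

theorem Triple.exists_perm {n : ℕ} {a b c : Fin n} (hab : a ≠ b) (hac : a ≠ c) (hbc : b ≠ c) :
    ∃ s : Triple n, (s.pt 0 = a ∧ s.pt 1 = b ∧ s.pt 2 = c) ∨
      (s.pt 0 = a ∧ s.pt 1 = c ∧ s.pt 2 = b) ∨
      (s.pt 0 = b ∧ s.pt 1 = a ∧ s.pt 2 = c) ∨ (s.pt 0 = b ∧ s.pt 1 = c ∧ s.pt 2 = a) ∨
      (s.pt 0 = c ∧ s.pt 1 = a ∧ s.pt 2 = b) ∨ (s.pt 0 = c ∧ s.pt 1 = b ∧ s.pt 2 = a) := by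
  let s : Triple n := ⟨{a, b, c}, Finset.card_eq_three.2 ⟨a, b, c, hab, hac, hbc, rfl⟩⟩
  have hmem : ∀ i, s.pt i = a ∨ s.pt i = b ∨ s.pt i = c := fun i => by
    have h : s.pt i ∈ ({a, b, c} : Finset (Fin n)) := ((Finset.equivFinOfCardEq s.2).symm i).2
    simpa only [Finset.mem_insert, Finset.mem_singleton] using h
  have hinj : ∀ i j, s.pt i = s.pt j → i = j := fun i j h =>
    (Finset.equivFinOfCardEq s.2).symm.injective (Subtype.ext h)
  have h01 : s.pt 0 ≠ s.pt 1 := fun h => absurd (hinj 0 1 h) (by decide)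
  have h02 : s.pt 0 ≠ s.pt 2 := fun h => absurd (hinj 0 2 h) (by decide)
  have h12 : s.pt 1 ≠ s.pt 2 := fun h => absurd (hinj 1 2 h) (by decide)
  clear_value s
  refine ⟨s, ?_⟩
  rcases hmem 0 with h0 | h0 | h0 <;> rcases hmem 1 with h1 | h1 | h1 <;>
    rcases hmem 2 with h2 | h2 | h2 <;> simp_all

/-- The points are in general position. -/
def GenPos {n : ℕ} (p : Fin n → Plane) : Prop :=
  ∀ a b c, a ≠ b → a ≠ c → b ≠ c → orient (p a) (p b) (p c) ≠ 0

/-- The chirotope of a point configuration. -/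
def chirotope {n : ℕ} (p : Fin n → Plane) (s : Triple n) : Bool :=
  decide (0 < orient (p (s.pt 0)) (p (s.pt 1)) (p (s.pt 2)))

theorem orient_pos_iff_of_chirotope_eq {n : ℕ} {p q : Fin n → Plane} (hp : GenPos p)
    (hq : GenPos q) (h : chirotope p = chirotope q) (a b c : Fin n) :
    0 < orient (p a) (p b) (p c) ↔ 0 < orient (q a) (q b) (q c) := by
  by_cases hab : a = b
  · subst hab; simp [orient]
  by_cases hac : a = c
  · subst hac; simp [orient]
  by_cases hbc : b = c
  · subst hbc; simp [orient, mul_comm]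
  obtain ⟨s, hs⟩ := Triple.exists_perm hab hac hbc
  have h1 := congrFun h s
  simp only [chirotope, decide_eq_decide] at h1
  have h2 : 0 < -orient (p a) (p b) (p c) ↔ ¬ 0 < orient (p a) (p b) (p c) := by
    have := hp a b c hab hac hbc
    constructor
    · intro h; linarith
    · intro h; rcases lt_or_gt_of_ne this with h' | h' <;> linarith
  have h3 : 0 < -orient (q a) (q b) (q c) ↔ ¬ 0 < orient (q a) (q b) (q c) := by
    have := hq a b c hab hac hbc
    constructor
    · intro h; linarith
    · intro h; rcases lt_or_gt_of_ne this with h' | h' <;> linarith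
  have e1 : ∀ x y z : Plane, orient x z y = - orient x y z := fun x y z => by
    simp only [orient]; ring
  have e2 : ∀ x y z : Plane, orient z x y = orient x y z := fun x y z => by
    simp only [orient]; ring
  have e3 : ∀ x y z : Plane, orient z y x = - orient x y z := fun x y z => by
    simp only [orient]; ring
  rcases hs with ⟨h0, h0', h0''⟩ | ⟨h0, h0', h0''⟩ | ⟨h0, h0', h0''⟩ | ⟨h0, h0', h0''⟩ |
    ⟨h0, h0', h0''⟩ | ⟨h0, h0', h0''⟩ <;> rw [h0, h0', h0''] at h1
  · exact h1
  · rwa [e1, e1 (q a), h2, h3, not_iff_not] at h1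
  · rwa [orient_swap, orient_swap (q a), h2, h3, not_iff_not] at h1
  · rwa [orient_rotate, orient_rotate (q a)] at h1
  · rwa [e2, e2 (q a)] at h1
  · rwa [e3, e3 (q a), h2, h3, not_iff_not] at h1

theorem card_chirotopes_le (n : ℕ) (S : Finset (Triple (n + 1) → Bool))
    (hS : ∀ s ∈ S, ∃ p : Fin (n + 1) → Plane, GenPos p ∧ chirotope p = s) :
    S.card ≤ ((n + 1).choose 3 + 1) * ((n + n + 1) *
      (2 ^ (n + n) * (((n + 1).choose 3 + (n + n)).choose (n + n) * 8 ^ n))) := by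
  classical
  let e : Fin (n + n) → ℕ := Fin.addCases (fun _ => 4) fun _ => 2
  let w : Fin (n + n) → ℕ := Fin.addCases (fun _ => 1) fun _ => 2
  let X : Fin (n + 1) → MvPolynomial (Fin (n + n)) ℝ :=
    Fin.cases 0 fun i => MvPolynomial.X (Fin.castAdd n i)
  let Y : Fin (n + 1) → MvPolynomial (Fin (n + n)) ℝ :=
    Fin.cases 0 fun i => MvPolynomial.X (Fin.natAdd n i)
  have heL : ∀ i, e (Fin.castAdd n i) = 4 := fun i => Fin.addCases_left i
  have heR : ∀ i, e (Fin.natAdd n i) = 2 := fun i => Fin.addCases_right i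
  have hwL : ∀ i, w (Fin.castAdd n i) = 1 := fun i => Fin.addCases_left i
  have hwR : ∀ i, w (Fin.natAdd n i) = 2 := fun i => Fin.addCases_right i
  have hX : ∀ i, LowWeight w (1 + 1) (X i) := fun i => by
    refine Fin.cases ?_ (fun i => ?_) i
    · intro β hβ; simp [X] at hβ
    · have := lowWeight_X w (Fin.castAdd n i)
      rwa [hwL] at this
  have hY : ∀ i, LowWeight w (2 + 1) (Y i) := fun i => by
    refine Fin.cases ?_ (fun i => ?_) i
    · intro β hβ; simp [Y] at hβ
    · have := lowWeight_X w (Fin.natAdd n i)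
      rwa [hwR] at this
  let p : Triple (n + 1) → MvPolynomial (Fin (n + n)) ℝ := fun s =>
    (X (s.pt 1) - X (s.pt 0)) * (Y (s.pt 2) - Y (s.pt 0))
      - (Y (s.pt 1) - Y (s.pt 0)) * (X (s.pt 2) - X (s.pt 0))
  have hp : ∀ s, LowWeight w 4 (p s) := fun s =>
    LowWeight.sub (((hX _).sub (hX _)).mul ((hY _).sub (hY _)))
      (((hY _).sub (hY _)).mul ((hX _).sub (hX _)))
  have hprod : ∏ i, e i = 8 ^ n := by
    rw [Fin.prod_univ_add]
    simp only [heL, heR, Finset.prod_const, Finset.card_univ, Fintype.card_fin, ← mul_pow]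
    norm_num
  have key := card_signPatterns_le (e := e) (w := w) (D := 4) (by norm_num)
    (fun i => Fin.addCases (fun i => by rw [hwL, heL]) (fun i => by rw [hwR, heR]) i)
    (fun i => Fin.addCases (fun i => by rw [heL]; decide) (fun i => by rw [heR]; decide) i) hp S (by
    intro s hs
    obtain ⟨q, hq, rfl⟩ := hS s hs
    refine ⟨Fin.addCases (fun i => q i.succ 0 - q 0 0) fun i => q i.succ 1 - q 0 1, fun j => ?_⟩
    set x : Fin (n + n) → ℝ :=
      Fin.addCases (fun i => q i.succ 0 - q 0 0) fun i => q i.succ 1 - q 0 1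
    have hXe : ∀ i, MvPolynomial.eval x (X i) = q i 0 - q 0 0 := fun i => by
      refine Fin.cases ?_ (fun i => ?_) i
      · simp [X]
      · exact (MvPolynomial.eval_X _).trans (Fin.addCases_left i)
    have hYe : ∀ i, MvPolynomial.eval x (Y i) = q i 1 - q 0 1 := fun i => by
      refine Fin.cases ?_ (fun i => ?_) i
      · simp [Y]
      · exact (MvPolynomial.eval_X _).trans (Fin.addCases_right i)
    have hpe : MvPolynomial.eval x (p j) = orient (q (j.pt 0)) (q (j.pt 1)) (q (j.pt 2)) := by
      simp only [p, map_sub, map_mul, hXe, hYe, orient]; ring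
    have hinj : ∀ a b, a ≠ b → j.pt a ≠ j.pt b := fun a b hab h =>
      hab ((Finset.equivFinOfCardEq j.2).symm.injective (Subtype.ext h))
    have hne := hq (j.pt 0) (j.pt 1) (j.pt 2) (hinj _ _ (by decide)) (hinj _ _ (by decide))
      (hinj _ _ (by decide))
    rw [hpe, boolSign, chirotope]
    by_cases h : 0 < orient (q (j.pt 0)) (q (j.pt 1)) (q (j.pt 2))
    · simp [h]
    · simpa [h] using lt_of_le_of_ne (not_lt.1 h) hne)
  rw [hprod, Fintype.card_finset_len, Fintype.card_fin] at key
  exact key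

theorem eventually_quadratic_ne_zero {A B C : ℝ} (hC : C ≠ 0) :
    ∀ᶠ t in nhdsWithin (0 : ℝ) (Set.Ioi 0), A + B * t + C * t ^ 2 ≠ 0 ∧
      (0 < A → 0 < A + B * t + C * t ^ 2) := by
  have h1 : ∀ a b c : ℝ, a ≠ 0 → ∀ᶠ t in nhdsWithin (0 : ℝ) (Set.Ioi 0),
      a + b * t + c * t ^ 2 ≠ 0 := fun a b c ha => by
    have hc : ContinuousAt (fun t : ℝ => a + b * t + c * t ^ 2) 0 := by fun_prop
    exact (hc.eventually_ne (by simpa using ha)).filter_mono nhdsWithin_le_nhds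
  refine Filter.Eventually.and ?_ ?_
  · by_cases hA : A = 0
    · subst hA
      by_cases hB : B = 0
      · subst hB
        filter_upwards [self_mem_nhdsWithin] with t ht
        have : t ≠ 0 := ne_of_gt ht
        simpa using ⟨hC, this⟩
      · filter_upwards [h1 B C 0 hB, self_mem_nhdsWithin] with t h ht
        have : t ≠ 0 := ne_of_gt ht
        have h2 : 0 + B * t + C * t ^ 2 = t * (B + C * t + 0 * t ^ 2) := by ring
        rw [h2]
        exact mul_ne_zero this h
    · exact h1 A B C hA
  · by_cases hA : 0 < A
    · have hc : ContinuousAt (fun t : ℝ => A + B * t + C * t ^ 2) 0 := by fun_prop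
      have := (hc.eventually (lt_mem_nhds (by simpa using hA : (0 : ℝ) < _))).filter_mono
        (nhdsWithin_le_nhds (s := Set.Ioi 0))
      exact this.mono fun t ht _ => ht
    · exact Filter.Eventually.of_forall fun t h => (hA h).elim

theorem exists_genPos_perturbation {n : ℕ} (p : Fin n → Plane) :
    ∃ q : Fin n → Plane, GenPos q ∧
      ∀ a b c, 0 < orient (p a) (p b) (p c) → 0 < orient (q a) (q b) (q c) := by
  let q : ℝ → Fin n → Plane := fun t i => !₂[p i 0 + t * (i : ℕ), p i 1 + t * (i : ℕ) ^ 2]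
  have h : ∀ᶠ t in nhdsWithin (0 : ℝ) (Set.Ioi 0), ∀ a b c : Fin n, a ≠ b → a ≠ c → b ≠ c →
      orient (q t a) (q t b) (q t c) ≠ 0 ∧
        (0 < orient (p a) (p b) (p c) → 0 < orient (q t a) (q t b) (q t c)) := by
    refine Filter.eventually_all.2 fun a => Filter.eventually_all.2 fun b =>
      Filter.eventually_all.2 fun c => ?_
    by_cases hab : a = b
    · exact Filter.Eventually.of_forall fun t h => (h hab).elim
    by_cases hac : a = c
    · exact Filter.Eventually.of_forall fun t _ h => (h hac).elim
    by_cases hbc : b = c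
    · exact Filter.Eventually.of_forall fun t _ _ h => (h hbc).elim
    have hne : ∀ i j : Fin n, i ≠ j → ((i : ℕ) : ℝ) - (j : ℕ) ≠ 0 := fun i j hij => by
      rw [sub_ne_zero]
      exact fun h => hij (Fin.ext (by exact_mod_cast h))
    have hC : (((b : ℕ) : ℝ) - (a : ℕ)) * (((c : ℕ) : ℝ) - (a : ℕ)) * (((c : ℕ) : ℝ) - (b : ℕ))
        ≠ 0 :=
      mul_ne_zero (mul_ne_zero (hne _ _ (Ne.symm hab)) (hne _ _ (Ne.symm hac)))
        (hne _ _ (Ne.symm hbc))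
    have := eventually_quadratic_ne_zero (A := orient (p a) (p b) (p c))
      (B := (((b : ℕ) : ℝ) - (a : ℕ)) * (p c 1 - p a 1) + (p b 0 - p a 0) *
        (((c : ℕ) : ℝ) ^ 2 - (a : ℕ) ^ 2) - (((b : ℕ) : ℝ) ^ 2 - (a : ℕ) ^ 2) * (p c 0 - p a 0)
        - (p b 1 - p a 1) * (((c : ℕ) : ℝ) - (a : ℕ))) hC
    refine this.mono fun t ht _ _ _ => ?_
    have he : orient (q t a) (q t b) (q t c) =
        orient (p a) (p b) (p c) + ((((b : ℕ) : ℝ) - (a : ℕ)) * (p c 1 - p a 1) + (p b 0 - p a 0) *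
        (((c : ℕ) : ℝ) ^ 2 - (a : ℕ) ^ 2) - (((b : ℕ) : ℝ) ^ 2 - (a : ℕ) ^ 2) * (p c 0 - p a 0)
        - (p b 1 - p a 1) * (((c : ℕ) : ℝ) - (a : ℕ))) * t +
        ((((b : ℕ) : ℝ) - (a : ℕ)) * (((c : ℕ) : ℝ) - (a : ℕ)) *
          (((c : ℕ) : ℝ) - (b : ℕ))) * t ^ 2 := by
      simp [q, orient]; ring
    rw [he]
    exact ht
  obtain ⟨t, ht⟩ := h.exists
  refine ⟨q t, fun a b c hab hac hbc => (ht a b c hab hac hbc).1, fun a b c h => ?_⟩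
  refine (ht a b c ?_ ?_ ?_).2 h
  · rintro rfl; simp [orient] at h
  · rintro rfl; simp [orient] at h
  · rintro rfl; simp [orient, mul_comm] at h

/-- The point `x` lies in the open triangle `abc`. -/
def Inside (a b c x : Plane) : Prop :=
  (0 < orient a b x ∧ 0 < orient b c x ∧ 0 < orient c a x) ∨
    (orient a b x < 0 ∧ orient b c x < 0 ∧ orient c a x < 0)

theorem inside_rotate (a b c x : Plane) : Inside b c a x ↔ Inside a b c x := by
  unfold Inside; tauto

theorem inside_swap (a b c x : Plane) : Inside b a c x ↔ Inside a b c x := by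
  unfold Inside
  rw [orient_swap a b, orient_swap c a, orient_swap b c]
  simp only [Left.neg_pos_iff, Left.neg_neg_iff]
  tauto

theorem inside_swap_right (a b c x : Plane) : Inside a c b x ↔ Inside a b c x := by
  rw [inside_swap, ← inside_rotate]

theorem orient_add_orient_add_orient (a b c x : Plane) :
    orient a b x + orient b c x + orient c a x = orient a b c := by
  simp only [orient]; ring

theorem Inside.orient_ne_zero {a b c x : Plane} (h : Inside a b c x) : orient a b c ≠ 0 := by
  rw [← orient_add_orient_add_orient a b c x]
  rcases h with ⟨h1, h2, h3⟩ | ⟨h1, h2, h3⟩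
  · positivity
  · exact ne_of_lt (by linarith)

/-- Relations between the orientations of a triangle `abc`, a centre `v` and a point `x`. -/
theorem orient_center (a b c v x : Plane) :
    orient a b x = orient a b v + orient v b x - orient v a x ∧
    orient b c x = orient b c v + orient v c x - orient v b x ∧
    orient c a x = orient c a v + orient v a x - orient v c x ∧
    orient b c v * orient v a x + orient c a v * orient v b x + orient a b v * orient v c x = 0 ∧
    (orient b v x = - orient v b x ∧ orient c v x = - orient v c x ∧
      orient a v x = - orient v a x) := by
  simp only [orient]
  refine ⟨?_, ?_, ?_, ?_, ?_, ?_, ?_⟩ <;> ring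

theorem Inside.of_subtriangle {a b c v x : Plane} (hv : Inside a b c v) (hx : Inside a b v x) :
    Inside a b c x := by
  obtain ⟨e1, e2, e3, e4, e5, -, -⟩ := orient_center a b c v x
  unfold Inside at hv hx ⊢
  rw [e1, e2, e3]
  rw [e1, e5] at hx
  generalize orient a b v = P at *
  generalize orient b c v = Q at *
  generalize orient c a v = R at *
  generalize orient v a x = α at *
  generalize orient v b x = β at *
  generalize orient v c x = γ at *
  rcases hv with ⟨hP, hQ, hR⟩ | ⟨hP, hQ, hR⟩ <;> rcases hx with ⟨h1, h2, h3⟩ | ⟨h1, h2, h3⟩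
  · refine Or.inl ⟨h1, (mul_pos_iff_of_pos_left hP).1 ?_, (mul_pos_iff_of_pos_left hP).1 ?_⟩
    · nlinarith [mul_pos hQ h1, mul_pos hQ h2, mul_pos hR h2, mul_pos hP h2]
    · nlinarith [mul_pos hR h1, mul_pos hR h3, mul_pos hP h3, mul_pos hQ h3]
  · linarith
  · linarith
  · refine Or.inr ⟨h1, neg_of_mul_pos_right (a := P) ?_ hP.le,
      neg_of_mul_pos_right (a := P) ?_ hP.le⟩
    · nlinarith [mul_pos_of_neg_of_neg hQ h1, mul_pos_of_neg_of_neg hQ h2,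
        mul_pos_of_neg_of_neg hR h2, mul_pos_of_neg_of_neg hP h2]
    · nlinarith [mul_pos_of_neg_of_neg hR h1, mul_pos_of_neg_of_neg hR h3,
        mul_pos_of_neg_of_neg hP h3, mul_pos_of_neg_of_neg hQ h3]

theorem Inside.not_subtriangles {a b c v x : Plane} (hv : Inside a b c v) (h₁ : Inside a b v x) :
    ¬ Inside b c v x := by
  intro h₂
  obtain ⟨e1, e2, e3, e4, e5, e6, -⟩ := orient_center a b c v x
  unfold Inside at hv h₁ h₂
  rw [e1, e5] at h₁
  rw [e2, e6] at h₂
  rcases hv with ⟨hP, hQ, hR⟩ | ⟨hP, hQ, hR⟩ <;> rcases h₁ with ⟨h1, h2, h3⟩ | ⟨h1, h2, h3⟩ <;>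
    rcases h₂ with ⟨h4, h5, h6⟩ | ⟨h4, h5, h6⟩ <;> linarith

theorem Inside.not_inside_subtriangle {a b c v : Plane} (hv : Inside a b c v) :
    ¬ Inside a b v c := by
  intro h
  have h1 := hv.of_subtriangle h
  simp [Inside, orient, mul_comm] at h1

theorem orient_smul_eq (a b c x : Plane) :
    orient a b c • x = orient b c x • a + orient c a x • b + orient a b x • c := by
  ext i
  fin_cases i <;> simp [orient] <;> ring

theorem mem_segment_of_smul_eq {a b x : Plane} {s q r : ℝ} (hs : 0 < s) (hq : 0 ≤ q) (hr : 0 ≤ r)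
    (hqr : q + r = s) (h : s • x = q • a + r • b) : x ∈ segment ℝ a b := by
  refine ⟨q / s, r / s, by positivity, by positivity, by rw [← add_div, hqr, div_self hs.ne'], ?_⟩
  rw [div_eq_inv_mul, div_eq_inv_mul, mul_smul, mul_smul, ← smul_add, ← h, inv_smul_smul₀ hs.ne']

theorem mem_segment_of_orient_eq_zero {a b c x : Plane} (hS : 0 < orient a b c)
    (h₁ : orient a b x = 0) (h₂ : 0 ≤ orient b c x) (h₃ : 0 ≤ orient c a x) :
    x ∈ segment ℝ a b := by
  have h := orient_smul_eq a b c x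
  have h' := orient_add_orient_add_orient a b c x
  rw [h₁, zero_smul, add_zero] at h
  exact mem_segment_of_smul_eq hS h₂ h₃ (by linarith) h

theorem inside_iff_of_pos {a b c x : Plane} (hS : 0 < orient a b c) :
    Inside a b c x ↔ 0 < orient a b x ∧ 0 < orient b c x ∧ 0 < orient c a x := by
  refine ⟨fun h => h.resolve_right fun h => ?_, Or.inl⟩
  linarith [orient_add_orient_add_orient a b c x]

/-- A point of a triangle with centre `v` lies in one of the three subtriangles or on a spoke. -/
theorem Inside.exists_subtriangle {a b c v x : Plane} (hv : Inside a b c v) (hx : Inside a b c x) :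
    Inside a b v x ∨ Inside b c v x ∨ Inside a c v x ∨
      x ∈ segment ℝ a v ∨ x ∈ segment ℝ b v ∨ x ∈ segment ℝ c v := by
  wlog hS : 0 < orient a b c generalizing a b
  · have := this ((inside_swap ..).2 hv) ((inside_swap ..).2 hx)
      (by rw [orient_swap]; linarith [lt_of_le_of_ne (not_lt.1 hS) hv.orient_ne_zero])
    rw [inside_swap a b] at this
    tauto
  rw [← inside_swap a c]
  obtain ⟨hP, hQ, hR⟩ := (inside_iff_of_pos hS).1 hv
  obtain ⟨h1, h2, h3⟩ := (inside_iff_of_pos hS).1 hx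
  rw [inside_iff_of_pos hP, inside_iff_of_pos hQ, inside_iff_of_pos hR]
  obtain ⟨-, -, -, e, eb, ec, ea⟩ := orient_center a b c v x
  have neg_of : ∀ {A B P Q R : ℝ}, 0 < P → 0 < Q → 0 < R → 0 < A → Q * 0 + R * A + P * B = 0 →
      B < 0 := by
    intro A B P Q R hP hQ hR hA h
    by_contra! hB
    nlinarith [mul_pos hR hA, mul_nonneg hP.le hB]
  rcases lt_trichotomy (orient v a x) 0 with hα | hα | hα
  · rcases lt_trichotomy (orient v c x) 0 with hγ | hγ | hγ
    · rcases lt_or_ge 0 (orient v b x) with hβ | hβ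
      · exact Or.inr (Or.inl ⟨h2, by linarith, hβ⟩)
      · nlinarith [mul_neg_of_pos_of_neg hQ hα, mul_neg_of_pos_of_neg hP hγ,
          mul_nonneg hR.le (neg_nonneg.2 hβ)]
    · right; right; right; right; right
      rw [segment_symm]
      have hR' : 0 < orient v c a := by rwa [orient_rotate, orient_rotate]
      exact mem_segment_of_orient_eq_zero hR' hγ h3.le (by linarith)
    · exact Or.inr (Or.inr (Or.inl ⟨h3, by linarith, hγ⟩))
  · rcases lt_or_ge 0 (orient v b x) with hβ | hβ
    · rw [hα] at e
      exact Or.inr (Or.inl ⟨h2, by linarith [neg_of hP hQ hR hβ e], hβ⟩)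
    · right; right; right; left
      rw [segment_symm]
      have hP' : 0 < orient v a b := by rwa [orient_rotate, orient_rotate]
      exact mem_segment_of_orient_eq_zero hP' hα h1.le (by linarith)
  · rcases lt_trichotomy (orient v b x) 0 with hβ | hβ | hβ
    · exact Or.inl ⟨h1, by linarith, hα⟩
    · rcases lt_or_ge 0 (orient v c x) with hγ | hγ
      · nlinarith [mul_pos hQ hα, mul_pos hP hγ]
      · right; right; right; right; left
        rw [segment_symm]
        have hQ' : 0 < orient v b c := by rwa [orient_rotate, orient_rotate]
        exact mem_segment_of_orient_eq_zero hQ' hβ h2.le (by linarith)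
    · rcases lt_or_ge (orient v c x) 0 with hγ | hγ
      · exact Or.inr (Or.inl ⟨h2, by linarith, hβ⟩)
      · nlinarith [mul_pos hQ hα, mul_pos hR hβ, mul_nonneg hP.le hγ]

/-- One of the four points lies in the open triangle spanned by the other three. -/
def Nested (a b c d : Plane) : Prop :=
  Inside a b c d ∨ Inside b c d a ∨ Inside a c d b ∨ Inside a b d c

theorem nested_swap_right (a b c d : Plane) : Nested a b d c ↔ Nested a b c d := by
  unfold Nested
  rw [inside_swap_right b c d, inside_swap_right a c d]
  tauto

theorem nested_swap_middle (a b c d : Plane) : Nested a c b d ↔ Nested a b c d := by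
  unfold Nested
  rw [inside_swap_right a b c, inside_swap b c d]
  tauto

theorem nested_swap_left (a b c d : Plane) : Nested b a c d ↔ Nested a b c d := by
  unfold Nested
  rw [inside_swap a b c, inside_swap a b d]
  tauto

/-- The triangle `abc` separates `x` from `d`. -/
def TriSep (a b c d x : Plane) : Prop := ¬ (Inside a b c x ↔ Inside a b c d)

theorem triSep_swap (a b c d x : Plane) : TriSep b a c d x ↔ TriSep a b c d x := by
  simp only [TriSep, inside_swap]

theorem triSep_swap_right (a b c d x : Plane) : TriSep a c b d x ↔ TriSep a b c d x := by
  simp only [TriSep, inside_swap_right]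

theorem Nested.not_sep {a b c d x : Plane} (h : Nested a b c d) (h₁ : TriSep a b c d x) :
    ¬ TriSep a b d c x := by
  intro h₂
  unfold TriSep at h₁ h₂
  have key : ∀ {a b c d : Plane}, Inside b c d a → Inside a b c x → Inside a b d x → False := by
    intro a b c d h h1 h2
    refine Inside.not_subtriangles (a := c) (b := b) (c := d) (v := a) (x := x)
      ((inside_swap ..).2 h) ?_ ?_
    · rw [inside_swap, inside_rotate]; exact h1
    · rw [← inside_rotate] at h2; exact h2
  have out : ∀ {a b c d : Plane}, Inside b c d a → ¬ Inside a b c d := by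
    intro a b c d h h1
    rw [← inside_rotate] at h1
    exact h.not_inside_subtriangle h1
  rcases h with h | h | h | h
  · have h3 := h.not_inside_subtriangle
    have h4 := fun h' => h.of_subtriangle (x := x) h'
    tauto
  · have h3 := out h
    have h4 := out ((inside_swap_right ..).2 h)
    have h5 := key h
    tauto
  · have h3 := out h
    have h4 := out ((inside_swap_right ..).2 h)
    have h5 := key h
    rw [inside_swap a b c, inside_swap a b d] at *
    tauto
  · have h3 := h.not_inside_subtriangle
    have h4 := fun h' => h.of_subtriangle (x := x) h'
    tauto

theorem Nested.exists_sep {a b c d x : Plane} (h : Nested a b c d)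
    (hab : x ∉ segment ℝ a b) (hac : x ∉ segment ℝ a c) (had : x ∉ segment ℝ a d)
    (hbc : x ∉ segment ℝ b c) (hbd : x ∉ segment ℝ b d) (hcd : x ∉ segment ℝ c d) :
    TriSep a b c d x ∨ TriSep a b d c x ∨ TriSep b c d a x ∨ TriSep a c d b x := by
  have key : ∀ {a b c d : Plane}, Inside a b c d → x ∉ segment ℝ a d → x ∉ segment ℝ b d →
      x ∉ segment ℝ c d → TriSep a b c d x ∨ TriSep a b d c x ∨
        TriSep b c d a x ∨ TriSep a c d b x := by
    intro a b c d h h1 h2 h3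
    have e1 := h.not_inside_subtriangle
    have e2 := ((inside_rotate ..).2 h).not_inside_subtriangle
    have e3 := ((inside_swap_right ..).2 h).not_inside_subtriangle
    have e4 := fun h' => h.exists_subtriangle (x := x) h'
    unfold TriSep
    tauto
  rcases h with h | h | h | h
  · exact key h had hbd hcd
  · have := key h (by rwa [segment_symm]) (by rwa [segment_symm]) (by rwa [segment_symm])
    have e1 : TriSep b c a d x ↔ TriSep a b c d x := by rw [triSep_swap_right, triSep_swap]
    have e2 : TriSep c d a b x ↔ TriSep a c d b x := by rw [triSep_swap_right, triSep_swap]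
    have e3 : TriSep b d a c x ↔ TriSep a b d c x := by rw [triSep_swap_right, triSep_swap]
    tauto
  · have := key h hab (by rwa [segment_symm]) (by rwa [segment_symm])
    have e1 : TriSep a c b d x ↔ TriSep a b c d x := by rw [triSep_swap_right]
    have e2 : TriSep c d b a x ↔ TriSep b c d a x := by rw [triSep_swap_right, triSep_swap]
    have e3 : TriSep a d b c x ↔ TriSep a b d c x := by rw [triSep_swap_right]
    tauto
  · have := key h hac hbc (by rwa [segment_symm])
    have e2 : TriSep b d c a x ↔ TriSep b c d a x := by rw [triSep_swap_right]
    have e3 : TriSep a d c b x ↔ TriSep a c d b x := by rw [triSep_swap_right]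
    tauto

theorem continuous_orient_lineMap (a b p w : Plane) :
    Continuous fun s : ℝ => orient a b (AffineMap.lineMap p w s) := by
  simp only [orient, AffineMap.lineMap_apply_module, PiLp.add_apply, PiLp.smul_apply, smul_eq_mul]
  fun_prop

/-- A segment from the inside of a triangle to its outside meets a side. -/
theorem Inside.exists_mem_side {a b c p w : Plane} (hp : Inside a b c p) (hw : ¬ Inside a b c w) :
    ∃ z ∈ segment ℝ p w, z ∈ segment ℝ a b ∨ z ∈ segment ℝ b c ∨ z ∈ segment ℝ a c := by
  wlog hS : 0 < orient a b c generalizing a b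
  · have := this ((inside_swap ..).2 hp) (by rwa [inside_swap])
      (by rw [orient_swap]; linarith [lt_of_le_of_ne (not_lt.1 hS) hp.orient_ne_zero])
    rw [segment_symm ℝ b a] at this
    obtain ⟨z, hz, h⟩ := this
    exact ⟨z, hz, by tauto⟩
  rw [inside_iff_of_pos hS] at hp hw
  let g : ℝ → ℝ := fun s => min (orient a b (AffineMap.lineMap p w s))
    (min (orient b c (AffineMap.lineMap p w s)) (orient c a (AffineMap.lineMap p w s)))
  have hg : Continuous g := (continuous_orient_lineMap a b p w).min
    ((continuous_orient_lineMap b c p w).min (continuous_orient_lineMap c a p w))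
  have h0 : 0 ≤ g 0 := by
    simp only [g, AffineMap.lineMap_apply_zero, le_min_iff]
    exact ⟨hp.1.le, hp.2.1.le, hp.2.2.le⟩
  have h1 : g 1 ≤ 0 := by
    by_contra! h
    simp only [g, AffineMap.lineMap_apply_one, lt_min_iff] at h
    exact hw h
  obtain ⟨s, hs, h⟩ := intermediate_value_Icc' zero_le_one hg.continuousOn ⟨h1, h0⟩
  refine ⟨AffineMap.lineMap p w s, by rw [segment_eq_image_lineMap]; exact ⟨s, hs, rfl⟩, ?_⟩
  have hm : min (orient a b (AffineMap.lineMap p w s)) (min (orient b c (AffineMap.lineMap p w s))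
    (orient c a (AffineMap.lineMap p w s))) = 0 := h
  generalize (AffineMap.lineMap p w s : Plane) = z at hm ⊢
  have hn := le_of_eq hm.symm
  rw [le_min_iff, le_min_iff] at hn
  obtain ⟨hn1, hn2, hn3⟩ := hn
  rcases min_choice (orient a b z) (min (orient b c z) (orient c a z)) with e | e
  · exact Or.inl (mem_segment_of_orient_eq_zero hS (e ▸ hm) hn2 hn3)
  · rcases min_choice (orient b c z) (orient c a z) with e' | e'
    · exact Or.inr (Or.inl (mem_segment_of_orient_eq_zero (c := a) (by rwa [orient_rotate])
        (by rw [← e', ← e, hm]) hn3 hn1))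
    · rw [segment_symm ℝ a c]
      exact Or.inr (Or.inr (mem_segment_of_orient_eq_zero (c := b) (by rwa [← orient_rotate])
        (by rw [← e', ← e, hm]) hn1 hn2))

section Embedding

variable {V : Type*} {G : SimpleGraph V} {π : V → Plane}

theorem IsSLEmbedding.not_mem_segment (h : IsSLEmbedding G π) {u v w : V} (huv : G.Adj u v)
    (hu : w ≠ u) (hv : w ≠ v) : π w ∉ segment ℝ (π u) (π v) := by
  rw [← insert_endpoints_openSegment]
  rintro (hw | hw | hw)
  · exact hu (h.1 hw)
  · exact hv (h.1 hw)
  · exact h.2.2 u v w huv hu hv hw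

theorem IsSLEmbedding.not_mem_of_disjoint (h : IsSLEmbedding G π) {u v x y : V} (huv : G.Adj u v)
    (hxy : G.Adj x y) (hux : u ≠ x) (huy : u ≠ y) (hvx : v ≠ x) (hvy : v ≠ y) {z : Plane}
    (hz : z ∈ segment ℝ (π u) (π v)) : z ∉ segment ℝ (π x) (π y) := by
  intro hz'
  obtain ⟨w, ⟨hw₁, hw₂⟩, -⟩ := h.2.1 u v x y huv hxy (by simp [hux, huy]) ⟨hz, hz'⟩
  rcases hw₁ with rfl | rfl <;> rcases hw₂ with rfl | rfl <;> contradiction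

theorem collinear_of_orient_eq_zero {a b c : Plane} (h : orient a b c = 0) :
    Collinear ℝ {a, b, c} := by
  by_cases hab : a = b
  · subst hab
    simpa using collinear_pair ℝ a c
  set D := (b 0 - a 0) ^ 2 + (b 1 - a 1) ^ 2 with hD
  have hD0 : D ≠ 0 := by
    intro h0
    apply hab
    ext i
    fin_cases i <;> simp <;> nlinarith [sq_nonneg (b 0 - a 0), sq_nonneg (b 1 - a 1)]
  refine (collinear_iff_of_mem (p₀ := a) (by simp)).2 ⟨b - a, ?_⟩
  simp only [Set.mem_insert_iff, Set.mem_singleton_iff, forall_eq_or_imp, forall_eq]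
  refine ⟨⟨0, by simp⟩, ⟨1, by simp⟩,
    ((c 0 - a 0) * (b 0 - a 0) + (c 1 - a 1) * (b 1 - a 1)) / D, ?_⟩
  unfold orient at h
  ext i
  fin_cases i
  · simp only [Fin.zero_eta, vadd_eq_add, PiLp.add_apply, PiLp.smul_apply, PiLp.sub_apply,
      smul_eq_mul]
    field_simp
    rw [hD]
    linear_combination -(b 1 - a 1) * h
  · simp only [Fin.mk_one, vadd_eq_add, PiLp.add_apply, PiLp.smul_apply, PiLp.sub_apply,
      smul_eq_mul]
    field_simp
    rw [hD]
    linear_combination (b 0 - a 0) * h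

theorem IsSLEmbedding.orient_ne_zero (h : IsSLEmbedding G π) {a b c : V} (hab : G.Adj a b)
    (hbc : G.Adj b c) (hac : G.Adj a c) : orient (π a) (π b) (π c) ≠ 0 := by
  intro h0
  rcases (collinear_of_orient_eq_zero h0).wbtw_or_wbtw_or_wbtw with h1 | h1 | h1
  · exact h.not_mem_segment hac hab.ne' hbc.ne (mem_segment_iff_wbtw.2 h1)
  · exact h.not_mem_segment hab.symm hbc.ne' hac.ne' (mem_segment_iff_wbtw.2 h1)
  · exact h.not_mem_segment hbc.symm hac.ne hab.ne (mem_segment_iff_wbtw.2 h1)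

theorem exists_crossing {a b c d : Plane} (h : 0 < orient a b c) (hd : orient a b d < 0)
    (h₁ : 0 < orient b c d) (h₂ : 0 < orient c a d) :
    ∃ z ∈ segment ℝ a b, z ∈ segment ℝ c d := by
  have e := orient_smul_eq a b c d
  have e' := orient_add_orient_add_orient a b c d
  set s := orient b c d + orient c a d with hs
  have hs0 : 0 < s := by positivity
  refine ⟨s⁻¹ • (orient b c d • a + orient c a d • b), ?_, ?_⟩
  · exact mem_segment_of_smul_eq hs0 h₁.le h₂.le rfl (smul_inv_smul₀ hs0.ne' _)
  · refine mem_segment_of_smul_eq (q := -orient a b d) hs0 (by linarith) h.le (by linarith) ?_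
    rw [smul_inv_smul₀ hs0.ne', e]
    module

theorem IsSLEmbedding.nested (h : IsSLEmbedding G π) {a b c d : V} (hab : G.Adj a b)
    (hac : G.Adj a c) (had : G.Adj a d) (hbc : G.Adj b c) (hbd : G.Adj b d) (hcd : G.Adj c d) :
    Nested (π a) (π b) (π c) (π d) := by
  wlog hS : 0 < orient (π a) (π b) (π c) generalizing a b
  · rw [← nested_swap_left]
    refine this hab.symm hbc hbd hac had ?_
    rw [orient_swap]
    linarith [lt_of_le_of_ne (not_lt.1 hS) (h.orient_ne_zero hab hbc hac)]
  have e := orient_add_orient_add_orient (π a) (π b) (π c) (π d)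
  have n1 := h.orient_ne_zero hab hbd had
  have n2 := h.orient_ne_zero hbc hcd hbd
  have n3 := h.orient_ne_zero hac.symm had hcd
  have cross : ∀ {a b c d : V}, G.Adj a b → G.Adj c d → G.Adj a c → G.Adj a d → G.Adj b c →
      G.Adj b d → 0 < orient (π a) (π b) (π c) → orient (π a) (π b) (π d) < 0 →
      0 < orient (π b) (π c) (π d) → 0 < orient (π c) (π a) (π d) → False := by
    intro a b c d hab hcd hac had hbc hbd k1 k2 k3 k4
    obtain ⟨z, hz, hz'⟩ := exists_crossing k1 k2 k3 k4
    exact h.not_mem_of_disjoint hab hcd hac.ne had.ne hbc.ne hbd.ne hz hz'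
  have hS' : 0 < orient (π b) (π c) (π a) := by rwa [orient_rotate]
  have hS'' : 0 < orient (π c) (π a) (π b) := by rwa [orient_rotate]
  have reverse : ∀ x y z : Plane, orient z y x = - orient x y z := by
    intro x y z
    rw [orient_swap y z x, orient_rotate]
  unfold Nested Inside
  rcases n1.lt_or_gt with h1 | h1 <;> rcases n2.lt_or_gt with h2 | h2 <;>
    rcases n3.lt_or_gt with h3 | h3
  · linarith
  · refine Or.inr (Or.inr (Or.inl (Or.inr ⟨?_, ?_, ?_⟩)))
    · linarith [reverse (π a) (π c) (π b), orient_rotate (π a) (π b) (π c),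
        orient_rotate (π b) (π c) (π a)]
    · rwa [orient_rotate]
    · rwa [← orient_rotate]
  · refine Or.inr (Or.inl (Or.inl ⟨hS', ?_, ?_⟩))
    · linarith [orient_swap (π c) (π d) (π a), orient_rotate (π c) (π a) (π d),
        reverse (π a) (π d) (π c)]
    · linarith [reverse (π a) (π b) (π d)]
  · exact (cross hab hcd hac had hbc hbd hS h1 h2 h3).elim
  · refine Or.inr (Or.inr (Or.inr (Or.inl ⟨hS, ?_, ?_⟩)))
    · linarith [reverse (π b) (π d) (π c), orient_rotate (π b) (π c) (π d),
        orient_rotate (π c) (π d) (π b)]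
    · linarith [reverse (π c) (π a) (π d)]
  · exact (cross hbc had hab.symm hbd hac.symm hcd hS' h2 h3 h1).elim
  · exact (cross hac.symm hbd hbc.symm hcd hab had hS'' h3 h1 h2).elim
  · exact Or.inl (Or.inl ⟨h1, h2, h3⟩)

/-- In a straight-line drawing, the triangle of a copy of `K₄` separates its fourth vertex from
every further vertex adjacent to the whole triangle. -/
theorem IsSLEmbedding.triSep (h : IsSLEmbedding G π) {a b c d v : V} (hab : G.Adj a b)
    (hac : G.Adj a c) (had : G.Adj a d) (hbc : G.Adj b c) (hbd : G.Adj b d) (hcd : G.Adj c d)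
    (hav : G.Adj a v) (hbv : G.Adj b v) (hcv : G.Adj c v) (hdv : v ≠ d) :
    TriSep (π a) (π b) (π c) (π d) (π v) := by
  have key : ∀ {a b c d : V}, G.Adj a b → G.Adj b c → G.Adj a c → G.Adj d v →
      d ≠ a → d ≠ b → d ≠ c → v ≠ a → v ≠ b → v ≠ c → ¬ TriSep (π a) (π b) (π c) (π d) (π v) := by
    intro a b c d hab hbc hac hdv da db dc va vb vc hs
    have : ∃ z ∈ segment ℝ (π d) (π v), z ∈ segment ℝ (π a) (π b) ∨ z ∈ segment ℝ (π b) (π c) ∨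
        z ∈ segment ℝ (π a) (π c) := by
      by_cases hd : Inside (π a) (π b) (π c) (π d)
      · exact hd.exists_mem_side fun hv => hs (iff_of_true hv hd)
      · have hv : Inside (π a) (π b) (π c) (π v) := by
          by_contra hv
          exact hs (iff_of_false hv hd)
        rw [segment_symm]
        exact hv.exists_mem_side hd
    obtain ⟨z, hz, h1 | h1 | h1⟩ := this
    · exact h.not_mem_of_disjoint hdv hab da db va vb hz h1
    · exact h.not_mem_of_disjoint hdv hbc db dc vb vc hz h1
    · exact h.not_mem_of_disjoint hdv hac da dc va vc hz h1
  have va := hav.ne'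
  have vb := hbv.ne'
  have vc := hcv.ne'
  rcases (h.nested hab hac had hbc hbd hcd).exists_sep (h.not_mem_segment hab va vb)
    (h.not_mem_segment hac va vc) (h.not_mem_segment had va hdv) (h.not_mem_segment hbc vb vc)
    (h.not_mem_segment hbd vb hdv) (h.not_mem_segment hcd vc hdv) with h1 | h1 | h1 | h1
  · exact h1
  · exact (key hab hbd had hcv hac.ne' hbc.ne' hcd.ne va vb hdv h1).elim
  · exact (key hbc hcd hbd hav hab.ne hac.ne had.ne vb vc hdv h1).elim
  · exact (key hac hcd had hbv hab.ne' hbc.ne hbd.ne va vc hdv h1).elim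

end Embedding

/-- A triangular face `abc` of a stacked triangulation, together with the apex `d` of a triangle
on its other side. -/
structure Cell where
  a : ℕ
  b : ℕ
  c : ℕ
  d : ℕ

/-- The faces of a stacked triangulation after `t` insertions: the vertex `t + 3` is inserted into
the face with index `ch t`, which is thereby split into three. -/
def cells (ch : ℕ → ℕ) : ℕ → ℕ → Cell
  | 0, _ => ⟨0, 1, 2, 0⟩
  | t + 1, i =>
    if i = ch t then
      ⟨(cells ch t (ch t)).a, (cells ch t (ch t)).b, t + 3, (cells ch t (ch t)).c⟩
    else if i = 2 * t + 1 then
      ⟨(cells ch t (ch t)).b, (cells ch t (ch t)).c, t + 3, (cells ch t (ch t)).a⟩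
    else if i = 2 * t + 2 then
      ⟨(cells ch t (ch t)).a, (cells ch t (ch t)).c, t + 3, (cells ch t (ch t)).b⟩
    else cells ch t i

/-- The face receiving the vertex `t + 3`. -/
def splitCell (ch : ℕ → ℕ) (t : ℕ) : Cell := cells ch t (ch t)

theorem cells_congr {ch ch' : ℕ → ℕ} {t : ℕ} (h : ∀ s < t, ch s = ch' s) (i : ℕ) :
    cells ch t i = cells ch' t i := by
  induction t generalizing i with
  | zero => rfl
  | succ t ih =>
    have ih' := fun i => ih (fun s hs => h s (hs.trans t.lt_succ_self)) i
    simp only [cells, ih', h t t.lt_succ_self]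

/-- A property holds for the faces after an insertion if it holds for the three new faces and is
inherited by the others. -/
theorem cells_succ_cases {ch : ℕ → ℕ} {t i : ℕ} (hi : i < 2 * (t + 1) + 1) (P : Cell → Prop)
    (h : P (cells ch (t + 1) i)) :
    (i = ch t ∧ P ⟨(splitCell ch t).a, (splitCell ch t).b, t + 3, (splitCell ch t).c⟩) ∨
    (i = 2 * t + 1 ∧ P ⟨(splitCell ch t).b, (splitCell ch t).c, t + 3, (splitCell ch t).a⟩) ∨
    (i = 2 * t + 2 ∧ P ⟨(splitCell ch t).a, (splitCell ch t).c, t + 3, (splitCell ch t).b⟩) ∨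
    (i ≠ ch t ∧ i < 2 * t + 1 ∧ P (cells ch t i)) := by
  unfold cells at h
  unfold splitCell
  split_ifs at h with h1 h2 h3
  · exact Or.inl ⟨h1, h⟩
  · exact Or.inr (Or.inl ⟨h2, h⟩)
  · exact Or.inr (Or.inr (Or.inl ⟨h3, h⟩))
  · exact Or.inr (Or.inr (Or.inr ⟨h1, by omega, h⟩))

/-- The vertex `y` was joined to the earlier vertex `x` when it was inserted. -/
def StackRel (ch : ℕ → ℕ) (x y : ℕ) : Prop :=
  x < y ∧ (y < 3 ∨ ∃ t, y = t + 3 ∧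
    (x = (splitCell ch t).a ∨ x = (splitCell ch t).b ∨ x = (splitCell ch t).c))

/-- The stacked triangulation encoded by `ch`. -/
def stackGraph (ch : ℕ → ℕ) : SimpleGraph ℕ where
  Adj x y := StackRel ch x y ∨ StackRel ch y x
  symm := ⟨fun _ _ h => h.symm⟩
  loopless := ⟨fun _ h => by rcases h with h | h <;> exact h.1.false⟩

theorem stackGraph_adj_of_lt_three {ch : ℕ → ℕ} {x y : ℕ} (hx : x < 3) (hy : y < 3) (h : x ≠ y) :
    (stackGraph ch).Adj x y := by
  rcases h.lt_or_gt with h | h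
  · exact Or.inl ⟨h, Or.inl hy⟩
  · exact Or.inr ⟨h, Or.inl hx⟩

/-- The incidences of a face of the stacked triangulation with `k` vertices. -/
structure Cell.IsFace (f : Cell) (ch : ℕ → ℕ) (k : ℕ) : Prop where
  a_lt : f.a < k
  b_lt : f.b < k
  c_lt : f.c < k
  ab : (stackGraph ch).Adj f.a f.b
  bc : (stackGraph ch).Adj f.b f.c
  ac : (stackGraph ch).Adj f.a f.c

/-- The incidences of the apex of a face of the stacked triangulation with `k` vertices. -/
structure Cell.IsApex (f : Cell) (ch : ℕ → ℕ) (k : ℕ) : Prop where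
  d_lt : f.d < k
  ad : (stackGraph ch).Adj f.a f.d
  bd : (stackGraph ch).Adj f.b f.d
  cd : (stackGraph ch).Adj f.c f.d

theorem adj_of_splitCell {ch : ℕ → ℕ} {t : ℕ} (h : (splitCell ch t).IsFace ch (t + 3)) :
    (stackGraph ch).Adj (splitCell ch t).a (t + 3) ∧
    (stackGraph ch).Adj (splitCell ch t).b (t + 3) ∧
    (stackGraph ch).Adj (splitCell ch t).c (t + 3) :=
  ⟨Or.inl ⟨h.a_lt, Or.inr ⟨t, rfl, by simp⟩⟩, Or.inl ⟨h.b_lt, Or.inr ⟨t, rfl, by simp⟩⟩,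
    Or.inl ⟨h.c_lt, Or.inr ⟨t, rfl, by simp⟩⟩⟩

theorem isFace_cells {ch : ℕ → ℕ} (t i : ℕ) : (cells ch t i).IsFace ch (t + 3) := by
  induction t generalizing i with
  | zero =>
    refine ⟨?_, ?_, ?_, ?_, ?_, ?_⟩ <;> simp [cells, stackGraph_adj_of_lt_three]
  | succ t ih =>
    have hf : (splitCell ch t).IsFace ch (t + 3) := ih (ch t)
    obtain ⟨h1, h2, h3⟩ := adj_of_splitCell hf
    have ha := hf.a_lt
    have hb := hf.b_lt
    have hc := hf.c_lt
    unfold cells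
    split_ifs
    · exact ⟨by dsimp only; exact ha.trans (by omega), by dsimp only; exact hb.trans (by omega),
        by dsimp only; omega, hf.ab, h2, h1⟩
    · exact ⟨by dsimp only; exact hb.trans (by omega), by dsimp only; exact hc.trans (by omega),
        by dsimp only; omega, hf.bc, h3, h2⟩
    · exact ⟨by dsimp only; exact ha.trans (by omega), by dsimp only; exact hc.trans (by omega),
        by dsimp only; omega, hf.ac, h3, h1⟩
    · have hi := ih i
      exact ⟨hi.a_lt.trans (by omega), hi.b_lt.trans (by omega), hi.c_lt.trans (by omega),
        hi.ab, hi.bc, hi.ac⟩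

theorem isApex_cells {ch : ℕ → ℕ} (hch : ∀ t, ch t < 2 * t + 1) {t i : ℕ} (ht : 1 ≤ t)
    (hi : i < 2 * t + 1) : (cells ch t i).IsApex ch (t + 3) := by
  induction t generalizing i with
  | zero => omega
  | succ t ih =>
    have hf : (splitCell ch t).IsFace ch (t + 3) := isFace_cells t (ch t)
    obtain ⟨h1, h2, h3⟩ := adj_of_splitCell hf
    have ha := hf.a_lt
    have hb := hf.b_lt
    have hc := hf.c_lt
    have hlt := hch t
    unfold cells
    split_ifs
    · exact ⟨by dsimp only; exact hc.trans (by omega), hf.ac, hf.bc, h3.symm⟩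
    · exact ⟨by dsimp only; exact ha.trans (by omega), hf.ab.symm, hf.ac.symm, h1.symm⟩
    · exact ⟨by dsimp only; exact hb.trans (by omega), hf.ab, hf.bc.symm, h2.symm⟩
    · have hi' := ih (i := i) (by omega) (by omega)
      exact ⟨hi'.d_lt.trans (by omega), hi'.ad, hi'.bd, hi'.cd⟩

/-- The face `f`, drawn at the points `q`, separates its apex from `x`. -/
def Cell.Separates (f : Cell) (q : ℕ → Plane) (x : Plane) : Prop :=
  TriSep (q f.a) (q f.b) (q f.c) (q f.d) x

/-- The points `q` satisfy the combinatorial constraints which every straight-line drawing of the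
stacked triangulation with `m + 3` vertices encoded by `ch` satisfies. -/
def Compatible (ch : ℕ → ℕ) (m : ℕ) (q : ℕ → Plane) : Prop :=
  ∀ t < m, Nested (q (splitCell ch t).a) (q (splitCell ch t).b) (q (splitCell ch t).c) (q (t + 3)) ∧
    (1 ≤ t → (splitCell ch t).Separates q (q (t + 3)))

theorem TriSep.of_not {a b c d v x : Plane} (hv : TriSep a b c d v) (hx : ¬ TriSep a b c d x) :
    TriSep a b c v x := by
  unfold TriSep at *
  tauto

theorem Nested.pairwise_not_sep {a b c v : Plane} (h : Nested a b c v) (x : Plane) :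
    (TriSep a b v c x → ¬ TriSep b c v a x) ∧ (TriSep a b v c x → ¬ TriSep a c v b x) ∧
    (TriSep b c v a x → ¬ TriSep a c v b x) ∧ (TriSep a b c v x → ¬ TriSep a b v c x) ∧
    (TriSep a b c v x → ¬ TriSep b c v a x) ∧ (TriSep a b c v x → ¬ TriSep a c v b x) := by
  refine ⟨fun h₁ h₂ => ?_, fun h₁ h₂ => ?_, fun h₁ h₂ => ?_, fun h₁ h₂ => ?_, fun h₁ h₂ => ?_,
    fun h₁ h₂ => ?_⟩
  · refine Nested.not_sep (a := b) (b := v) (c := a) (d := c) (x := x) ?_ ?_ ?_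
    · rwa [nested_swap_middle, nested_swap_left, nested_swap_right]
    · rwa [triSep_swap_right, triSep_swap]
    · rwa [triSep_swap_right]
  · refine Nested.not_sep (a := a) (b := v) (c := b) (d := c) (x := x) ?_ ?_ ?_
    · rwa [nested_swap_middle, nested_swap_right]
    · rwa [triSep_swap_right]
    · rwa [triSep_swap_right]
  · refine Nested.not_sep (a := c) (b := v) (c := b) (d := a) (x := x) ?_ ?_ ?_
    · rwa [nested_swap_right, nested_swap_middle, nested_swap_left, nested_swap_right,
        nested_swap_middle]
    · rwa [triSep_swap_right, triSep_swap]
    · rwa [triSep_swap_right, triSep_swap]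
  · exact h.not_sep h₁ h₂
  · refine Nested.not_sep (a := b) (b := c) (c := a) (d := v) (x := x) ?_ ?_ h₂
    · rwa [nested_swap_middle, nested_swap_left]
    · rwa [triSep_swap_right, triSep_swap]
  · refine Nested.not_sep (a := a) (b := c) (c := b) (d := v) (x := x) ?_ ?_ h₂
    · rwa [nested_swap_middle]
    · rwa [triSep_swap_right]

theorem Compatible.index_unique {ch : ℕ → ℕ} (hch : ∀ t, ch t < 2 * t + 1) {m : ℕ} {q : ℕ → Plane}
    (h : Compatible ch m q) {t : ℕ} (ht : t ≤ m) {i j : ℕ} (hi : i < 2 * t + 1)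
    (hj : j < 2 * t + 1) {x : Plane} (hxi : (cells ch t i).Separates q x)
    (hxj : (cells ch t j).Separates q x) : i = j := by
  induction t generalizing i j with
  | zero => omega
  | succ t ih =>
    obtain ⟨hN, hS⟩ := h t ht
    have hlt := hch t
    have ih' : ∀ k, k ≠ ch t → k < 2 * t + 1 → (cells ch t k).Separates q x →
        TriSep (q (splitCell ch t).a) (q (splitCell ch t).b) (q (splitCell ch t).c)
          (q (t + 3)) x := by
      intro k hk hk' hs
      by_contra hx
      refine hk (ih (by omega) hk' hlt hs ?_)
      by_contra hd
      exact hx ((hS (by omega)).of_not hd)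
    obtain ⟨hAB, hAC, hBC, hA, hB, hC⟩ := hN.pairwise_not_sep x
    rcases cells_succ_cases hi (Cell.Separates · q x) hxi with ⟨i1, i2⟩ | ⟨i1, i2⟩ | ⟨i1, i2⟩ |
      ⟨i1, i2, i3⟩ <;>
    rcases cells_succ_cases hj (Cell.Separates · q x) hxj with ⟨j1, j2⟩ | ⟨j1, j2⟩ | ⟨j1, j2⟩ |
      ⟨j1, j2, j3⟩
    · exact i1.trans j1.symm
    · exact (hAB i2 j2).elim
    · exact (hAC i2 j2).elim
    · exact (hA (ih' j j1 j2 j3) i2).elim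
    · exact (hAB j2 i2).elim
    · exact i1.trans j1.symm
    · exact (hBC i2 j2).elim
    · exact (hB (ih' j j1 j2 j3) i2).elim
    · exact (hAC j2 i2).elim
    · exact (hBC j2 i2).elim
    · exact i1.trans j1.symm
    · exact (hC (ih' j j1 j2 j3) i2).elim
    · exact (hA (ih' i i1 i2 i3) j2).elim
    · exact (hB (ih' i i1 i2 i3) j2).elim
    · exact (hC (ih' i i1 i2 i3) j2).elim
    · exact ih (by omega) i2 j2 i3 j3

theorem Compatible.code_unique {ch ch' : ℕ → ℕ} (hch : ∀ t, ch t < 2 * t + 1)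
    (hch' : ∀ t, ch' t < 2 * t + 1) {m : ℕ} {q : ℕ → Plane}
    (h : Compatible ch m q) (h' : Compatible ch' m q) {t : ℕ} (ht : t < m) : ch t = ch' t := by
  induction t using Nat.strong_induction_on with
  | _ t ih =>
    rcases Nat.eq_zero_or_pos t with rfl | hpos
    · have := hch 0
      have := hch' 0
      omega
    have hcells := cells_congr fun s hs => ih s hs (hs.trans ht)
    refine h.index_unique hch ht.le (hch t) (hch' t) ((h t ht).2 hpos) ?_
    rw [hcells]
    exact (h' t ht).2 hpos

/-- The stacked triangulation with `m + 3` vertices encoded by `ch`. -/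
def stackGraphFin (ch : ℕ → ℕ) (m : ℕ) : SimpleGraph (Fin (m + 3)) :=
  (stackGraph ch).comap Fin.val

theorem stackGraphFin_adj_ofNat {ch : ℕ → ℕ} {m x y : ℕ} (h : (stackGraph ch).Adj x y)
    (hx : x < m + 3) (hy : y < m + 3) :
    (stackGraphFin ch m).Adj (Fin.ofNat (m + 3) x) (Fin.ofNat (m + 3) y) := by
  simpa [stackGraphFin, Nat.mod_eq_of_lt hx, Nat.mod_eq_of_lt hy] using h

theorem Inside.of_perturbation {V : Type*} {p q : V → Plane}
    (h : ∀ a b c, 0 < orient (p a) (p b) (p c) → 0 < orient (q a) (q b) (q c)) {a b c x : V}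
    (hx : Inside (p a) (p b) (p c) (p x)) : Inside (q a) (q b) (q c) (q x) := by
  have h' : ∀ a b c, orient (p a) (p b) (p c) < 0 → orient (q a) (q b) (q c) < 0 := by
    intro a b c hn
    rw [orient_swap, neg_lt_zero] at hn ⊢
    exact h _ _ _ hn
  exact hx.imp (fun hx => ⟨h _ _ _ hx.1, h _ _ _ hx.2.1, h _ _ _ hx.2.2⟩)
    (fun hx => ⟨h' _ _ _ hx.1, h' _ _ _ hx.2.1, h' _ _ _ hx.2.2⟩)

theorem inside_iff_of_perturbation {V : Type*} {p q : V → Plane}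
    (h : ∀ a b c, 0 < orient (p a) (p b) (p c) → 0 < orient (q a) (q b) (q c)) {a b c x : V}
    (h₁ : orient (p a) (p b) (p x) ≠ 0) (h₂ : orient (p b) (p c) (p x) ≠ 0)
    (h₃ : orient (p c) (p a) (p x) ≠ 0) :
    Inside (q a) (q b) (q c) (q x) ↔ Inside (p a) (p b) (p c) (p x) := by
  refine ⟨fun hx => ?_, Inside.of_perturbation h⟩
  have pos : ∀ {a b c}, orient (p a) (p b) (p c) ≠ 0 → 0 < orient (q a) (q b) (q c) →
      0 < orient (p a) (p b) (p c) := by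
    intro a b c hne hq
    refine hne.lt_or_gt.resolve_left fun hp => ?_
    have := h b a c (by rw [orient_swap]; linarith)
    rw [orient_swap] at this
    linarith
  have neg : ∀ {a b c}, orient (p a) (p b) (p c) ≠ 0 → orient (q a) (q b) (q c) < 0 →
      orient (p a) (p b) (p c) < 0 := by
    intro a b c hne hq
    refine hne.lt_or_gt.resolve_right fun hp => ?_
    linarith [h a b c hp]
  exact hx.imp (fun hx => ⟨pos h₁ hx.1, pos h₂ hx.2.1, pos h₃ hx.2.2⟩)
    (fun hx => ⟨neg h₁ hx.1, neg h₂ hx.2.1, neg h₃ hx.2.2⟩)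

/-- A small perturbation of a straight-line drawing of a stacked triangulation satisfies the
combinatorial constraints of the triangulation. -/
theorem IsSLEmbedding.compatible {ch : ℕ → ℕ} (hch : ∀ t, ch t < 2 * t + 1) {m : ℕ}
    {p q : Fin (m + 3) → Plane} (hp : IsSLEmbedding (stackGraphFin ch m) p)
    (h : ∀ a b c, 0 < orient (p a) (p b) (p c) → 0 < orient (q a) (q b) (q c)) :
    Compatible ch m fun k => q (Fin.ofNat (m + 3) k) := by
  intro t ht
  have hf : (splitCell ch t).IsFace ch (t + 3) := isFace_cells t (ch t)
  have apex : 1 ≤ t → (splitCell ch t).IsApex ch (t + 3) := fun h1 =>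
    isApex_cells hch h1 (hch t)
  obtain ⟨av, bv, cv⟩ := adj_of_splitCell hf
  generalize splitCell ch t = f at hf apex av bv cv ⊢
  have la : f.a < m + 3 := hf.a_lt.trans (by omega)
  have lb : f.b < m + 3 := hf.b_lt.trans (by omega)
  have lc : f.c < m + 3 := hf.c_lt.trans (by omega)
  have lv : t + 3 < m + 3 := by omega
  have ab := stackGraphFin_adj_ofNat hf.ab la lb
  have bc := stackGraphFin_adj_ofNat hf.bc lb lc
  have ac := stackGraphFin_adj_ofNat hf.ac la lc
  replace av := stackGraphFin_adj_ofNat av la lv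
  replace bv := stackGraphFin_adj_ofNat bv lb lv
  replace cv := stackGraphFin_adj_ofNat cv lc lv
  refine ⟨?_, fun h1 => ?_⟩
  · exact (hp.nested ab ac av bc bv cv).imp (Inside.of_perturbation h)
      (.imp (Inside.of_perturbation h) (.imp (Inside.of_perturbation h)
        (Inside.of_perturbation h)))
  · have hd := apex h1
    have ld : f.d < m + 3 := hd.d_lt.trans (by omega)
    have ad := stackGraphFin_adj_ofNat hd.ad la ld
    have bd := stackGraphFin_adj_ofNat hd.bd lb ld
    have cd := stackGraphFin_adj_ofNat hd.cd lc ld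
    have hne : Fin.ofNat (m + 3) (t + 3) ≠ Fin.ofNat (m + 3) f.d := by
      intro e
      have e' := congrArg Fin.val e
      simp only [Fin.val_ofNat, Nat.mod_eq_of_lt ld, Nat.mod_eq_of_lt lv] at e'
      have := hd.d_lt
      omega
    have hs := hp.triSep ab ac ad bc bd cd av bv cv hne
    unfold Cell.Separates TriSep at *
    rwa [inside_iff_of_perturbation h (hp.orient_ne_zero ab bv av) (hp.orient_ne_zero bc cv bv)
      (hp.orient_ne_zero ac.symm av cv), inside_iff_of_perturbation h
      (hp.orient_ne_zero ab bd ad) (hp.orient_ne_zero bc cd bd) (hp.orient_ne_zero ac.symm ad cd)]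

theorem Compatible.congr {ch : ℕ → ℕ} {m : ℕ} {q q' : ℕ → Plane} (h : Compatible ch m q)
    (hq : ∀ a b c, 0 < orient (q a) (q b) (q c) ↔ 0 < orient (q' a) (q' b) (q' c)) :
    Compatible ch m q' := by
  have hi : ∀ a b c x, Inside (q' a) (q' b) (q' c) (q' x) ↔ Inside (q a) (q b) (q c) (q x) :=
    fun a b c x => ⟨Inside.of_perturbation fun a b c => (hq a b c).2,
      Inside.of_perturbation fun a b c => (hq a b c).1⟩
  simpa only [Compatible, Cell.Separates, Nested, TriSep, hi] using h

theorem orient_eq_zero_of_mem_segment {a b z : Plane} (hz : z ∈ segment ℝ a b) :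
    orient a b z = 0 := by
  obtain ⟨s, r, -, -, hsr, rfl⟩ := hz
  obtain rfl : s = 1 - r := by linarith
  simp only [orient, PiLp.add_apply, PiLp.smul_apply, smul_eq_mul]
  ring

theorem eq_of_mem_segment_of_mem_segment {a b v z : Plane} (h : orient a b v ≠ 0)
    (ha : z ∈ segment ℝ a v) (hb : z ∈ segment ℝ b v) : z = v := by
  have ha' := orient_eq_zero_of_mem_segment (segment_symm ℝ a v ▸ ha)
  have hb' := orient_eq_zero_of_mem_segment hb
  have e := orient_smul_eq a b v z
  have e' := orient_add_orient_add_orient a b v z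
  rw [ha', hb', add_zero, add_zero] at e'
  rw [ha', hb', e', zero_smul, zero_smul, zero_add, zero_add] at e
  exact smul_right_injective _ h e

theorem orient_combo (a b x y : Plane) {s r : ℝ} (h : s + r = 1) :
    orient a b (s • x + r • y) = s * orient a b x + r * orient a b y := by
  obtain rfl : s = 1 - r := by linarith
  simp only [orient, PiLp.add_apply, PiLp.smul_apply, smul_eq_mul]
  ring

theorem orient_self_left (a b : Plane) : orient a b a = 0 := by
  simp [orient]

theorem orient_self_right (a b : Plane) : orient a b b = 0 := by
  simp [orient, mul_comm]

theorem inside_centroid {a b c : Plane} (h : orient a b c ≠ 0) :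
    Inside a b c ((3⁻¹ : ℝ) • (a + b + c)) := by
  have h1 : orient a b ((3⁻¹ : ℝ) • (a + b + c)) = 3⁻¹ * orient a b c := by
    simp only [orient, PiLp.add_apply, PiLp.smul_apply, smul_eq_mul]; ring
  have h2 : orient b c ((3⁻¹ : ℝ) • (a + b + c)) = 3⁻¹ * orient a b c := by
    simp only [orient, PiLp.add_apply, PiLp.smul_apply, smul_eq_mul]; ring
  have h3 : orient c a ((3⁻¹ : ℝ) • (a + b + c)) = 3⁻¹ * orient a b c := by
    simp only [orient, PiLp.add_apply, PiLp.smul_apply, smul_eq_mul]; ring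
  unfold Inside
  rw [h1, h2, h3]
  rcases h.lt_or_gt with h | h
  · exact Or.inr ⟨by linarith, by linarith, by linarith⟩
  · exact Or.inl ⟨by linarith, by linarith, by linarith⟩

theorem Inside.eq_or_inside_of_mem_spoke {a b c v w z : Plane} (hv : Inside a b c v)
    (hw : w = a ∨ w = b ∨ w = c) (hz : z ∈ segment ℝ w v) : z = w ∨ Inside a b c z := by
  have key : ∀ {a b c : Plane}, Inside a b c v → z ∈ segment ℝ a v → z = a ∨ Inside a b c z := by
    rintro a b c hv ⟨r, s, hr, hs, hrs, rfl⟩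
    rcases hs.eq_or_lt with rfl | hs
    · left
      simp [show r = 1 by linarith]
    right
    unfold Inside at hv ⊢
    rw [orient_combo _ _ _ _ hrs, orient_combo _ _ _ _ hrs, orient_combo _ _ _ _ hrs,
      orient_self_left, orient_self_right, orient_rotate a b c,
      ← orient_add_orient_add_orient a b c v]
    refine hv.imp (fun ⟨h1, h2, h3⟩ => ⟨by positivity, by positivity, by positivity⟩) ?_
    rintro ⟨h1, h2, h3⟩
    have k1 := mul_neg_of_pos_of_neg hs h1
    have k2 := mul_neg_of_pos_of_neg hs h2
    have k3 := mul_neg_of_pos_of_neg hs h3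
    have k4 : r * (orient a b v + orient b c v + orient c a v) ≤ 0 :=
      mul_nonpos_of_nonneg_of_nonpos hr (by linarith)
    exact ⟨by linarith, by linarith, by linarith⟩
  rcases hw with rfl | rfl | rfl
  · exact key hv hz
  · rw [← inside_rotate] at hv ⊢
    exact key hv hz
  · rw [← inside_rotate, ← inside_rotate] at hv ⊢
    exact key hv hz

theorem Inside.not_inside_of_mem_spoke {a b c v w z : Plane} (hv : Inside a b c v)
    (hw : w = a ∨ w = b ∨ w = c) (hz : z ∈ segment ℝ w v) : ¬ Inside a b v z := by
  intro h
  rcases hw with rfl | rfl | rfl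
  · have := orient_eq_zero_of_mem_segment (segment_symm ℝ w v ▸ hz)
    unfold Inside at h
    simp [this] at h
  · have := orient_eq_zero_of_mem_segment hz
    unfold Inside at h
    simp [this] at h
  · obtain ⟨r, s, hr, hs, hrs, rfl⟩ := hz
    have e : orient v a (r • w + s • v) = - (r * orient w a v) := by
      rw [orient_combo _ _ _ _ hrs, orient_self_left, ← orient_rotate v a w, orient_swap w a v]
      ring
    have e' := orient_add_orient_add_orient a b v (r • w + s • v)
    unfold Inside at h hv
    rcases h with ⟨h1, h2, h3⟩ | ⟨h1, h2, h3⟩ <;> rcases hv with ⟨k1, k2, k3⟩ | ⟨k1, k2, k3⟩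
    · linarith [mul_nonneg hr k3.le]
    · linarith
    · linarith
    · linarith [mul_nonpos_of_nonneg_of_nonpos hr k3.le]

theorem Inside.orients_ne_zero {a b c v : Plane} (hv : Inside a b c v) :
    orient a b v ≠ 0 ∧ orient b c v ≠ 0 ∧ orient a c v ≠ 0 := by
  rw [orient_swap c a, neg_ne_zero]
  rcases hv with ⟨h1, h2, h3⟩ | ⟨h1, h2, h3⟩
  · exact ⟨h1.ne', h2.ne', h3.ne'⟩
  · exact ⟨h1.ne, h2.ne, h3.ne⟩

theorem Inside.eq_of_mem_spokes {a b c v w w' z : Plane} (hv : Inside a b c v)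
    (hw : w = a ∨ w = b ∨ w = c) (hw' : w' = a ∨ w' = b ∨ w' = c) (hne : w ≠ w')
    (hz : z ∈ segment ℝ w v) (hz' : z ∈ segment ℝ w' v) : z = v := by
  obtain ⟨h1, h2, h3⟩ := hv.orients_ne_zero
  rcases hw with rfl | rfl | rfl <;> rcases hw' with rfl | rfl | rfl <;>
    first
    | exact absurd rfl hne
    | exact eq_of_mem_segment_of_mem_segment (by assumption) hz hz'
    | exact eq_of_mem_segment_of_mem_segment (by assumption) hz' hz

/-- A straight-line drawing of the stacked triangulation, each new vertex being the centroid of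
its face. -/
def stackPos (ch : ℕ → ℕ) : ℕ → Plane
  | 0 => !₂[0, 0]
  | 1 => !₂[1, 0]
  | 2 => !₂[0, 1]
  | t + 3 => (3⁻¹ : ℝ) • (stackPos ch (splitCell ch t).a + stackPos ch (splitCell ch t).b +
      stackPos ch (splitCell ch t).c)
decreasing_by
  · exact (isFace_cells t (ch t)).a_lt
  · exact (isFace_cells t (ch t)).b_lt
  · exact (isFace_cells t (ch t)).c_lt

/-- The point `z` lies in the open face `f`, drawn at the points `p`. -/
def Cell.Contains (f : Cell) (p : ℕ → Plane) (z : Plane) : Prop :=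
  Inside (p f.a) (p f.b) (p f.c) z

/-- The points `p` form a straight-line drawing of the stacked triangulation with `t + 3` vertices,
with the prescribed open faces. -/
structure Drawn (ch : ℕ → ℕ) (t : ℕ) (p : ℕ → Plane) : Prop where
  inj : ∀ u v, u < t + 3 → v < t + 3 → p u = p v → u = v
  cross : ∀ u v x y, StackRel ch u v → StackRel ch x y → v < t + 3 → y < t + 3 →
    ¬ (u = x ∧ v = y) → ∀ z ∈ segment ℝ (p u) (p v), z ∈ segment ℝ (p x) (p y) →
    ∃ w, (w = u ∨ w = v) ∧ (w = x ∨ w = y) ∧ p w = z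
  vert : ∀ u v w, StackRel ch u v → v < t + 3 → w < t + 3 → w ≠ u → w ≠ v →
    p w ∉ segment ℝ (p u) (p v)
  orient_ne : ∀ i < 2 * t + 1,
    orient (p (cells ch t i).a) (p (cells ch t i).b) (p (cells ch t i).c) ≠ 0
  face_edge : ∀ i < 2 * t + 1, ∀ u v, StackRel ch u v → v < t + 3 →
    ∀ z ∈ segment ℝ (p u) (p v), ¬ (cells ch t i).Contains p z
  face_vert : ∀ i < 2 * t + 1, ∀ w < t + 3, ¬ (cells ch t i).Contains p (p w)
  face_disj : ∀ i < 2 * t + 1, ∀ j < 2 * t + 1, i ≠ j → ∀ z,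
    (cells ch t i).Contains p z → ¬ (cells ch t j).Contains p z

theorem StackRel.eq_corner {ch : ℕ → ℕ} {t u : ℕ} (h : StackRel ch u (t + 3)) :
    u = (splitCell ch t).a ∨ u = (splitCell ch t).b ∨ u = (splitCell ch t).c := by
  obtain ⟨-, h | ⟨s, hs, h⟩⟩ := h
  · omega
  · obtain rfl : t = s := by omega
    exact h

theorem drawn_zero (ch : ℕ → ℕ) : Drawn ch 0 (stackPos ch) := by
  have h012 : orient (stackPos ch 0) (stackPos ch 1) (stackPos ch 2) ≠ 0 := by
    simp [stackPos, orient]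
  generalize stackPos ch = p at h012
  have h120 : orient (p 1) (p 2) (p 0) ≠ 0 := by rwa [orient_rotate]
  have h201 : orient (p 2) (p 0) (p 1) ≠ 0 := by rwa [orient_rotate]
  have h021 : orient (p 0) (p 2) (p 1) ≠ 0 := by rwa [orient_swap, neg_ne_zero]
  have edges : ∀ u v, StackRel ch u v → v < 0 + 3 →
      (u = 0 ∧ v = 1) ∨ (u = 0 ∧ v = 2) ∨ (u = 1 ∧ v = 2) := by
    intro u v h hv
    have := h.1
    omega
  have side : ∀ u v, StackRel ch u v → v < 0 + 3 → ∀ z ∈ segment ℝ (p u) (p v),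
      ¬ Inside (p 0) (p 1) (p 2) z := by
    intro u v h hv z hz hin
    rcases edges u v h hv with ⟨rfl, rfl⟩ | ⟨rfl, rfl⟩ | ⟨rfl, rfl⟩
    · have := orient_eq_zero_of_mem_segment hz
      simp [Inside, this] at hin
    · rw [segment_symm] at hz
      have := orient_eq_zero_of_mem_segment hz
      simp [Inside, this] at hin
    · have := orient_eq_zero_of_mem_segment hz
      simp [Inside, this] at hin
  have rel : ∀ u v, u < v → v < 3 → StackRel ch u v := fun u v h hv => ⟨h, Or.inl hv⟩
  have inter : ∀ {a b c z : Plane}, orient a b c ≠ 0 → z ∈ segment ℝ a c → z ∈ segment ℝ b c →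
      z = c := eq_of_mem_segment_of_mem_segment
  constructor
  · intro u v hu hv h
    interval_cases u <;> interval_cases v <;>
      first
      | rfl
      | (exfalso; apply h012; rw [h]; simp only [orient]; ring)
  · intro u v x y huv hxy hv hy hne z hz hz'
    rcases edges u v huv hv with ⟨rfl, rfl⟩ | ⟨rfl, rfl⟩ | ⟨rfl, rfl⟩ <;>
      rcases edges x y hxy hy with ⟨rfl, rfl⟩ | ⟨rfl, rfl⟩ | ⟨rfl, rfl⟩ <;> try simp at hne
    · exact ⟨0, by simp, by simp,
        (inter h120 (segment_symm ℝ (p 0) _ ▸ hz) (segment_symm ℝ (p 0) _ ▸ hz')).symm⟩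
    · exact ⟨1, by simp, by simp, (inter h021 hz (segment_symm ℝ (p 1) _ ▸ hz')).symm⟩
    · exact ⟨0, by simp, by simp,
        (inter h120 (segment_symm ℝ (p 0) _ ▸ hz') (segment_symm ℝ (p 0) _ ▸ hz)).symm⟩
    · exact ⟨2, by simp, by simp, (inter h012 hz hz').symm⟩
    · exact ⟨1, by simp, by simp, (inter h021 hz' (segment_symm ℝ (p 1) _ ▸ hz)).symm⟩
    · exact ⟨2, by simp, by simp, (inter h012 hz' hz).symm⟩
  · intro u v w huv hv hw hwu hwv hz
    have hz0 := orient_eq_zero_of_mem_segment hz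
    rcases edges u v huv hv with ⟨rfl, rfl⟩ | ⟨rfl, rfl⟩ | ⟨rfl, rfl⟩
    · obtain rfl : w = 2 := by omega
      exact h012 hz0
    · obtain rfl : w = 1 := by omega
      exact h021 hz0
    · obtain rfl : w = 0 := by omega
      exact h120 hz0
  · intro i _
    exact h012
  · intro i _ u v huv hv z hz
    exact side u v huv hv z hz
  · intro i _ w hw
    rcases Nat.lt_or_ge w 2 with h | h
    · exact side w 2 (rel _ _ h (by omega)) (by omega) _ (left_mem_segment ..)
    · obtain rfl : w = 2 := by omega
      exact side 0 2 (rel _ _ (by omega) (by omega)) (by omega) _ (right_mem_segment ..)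
  · intro i hi j hj hij
    omega

theorem Drawn.succ {ch : ℕ → ℕ} (hch : ∀ t, ch t < 2 * t + 1) {t : ℕ} {p : ℕ → Plane}
    (h : Drawn ch t p) (hv : (splitCell ch t).Contains p (p (t + 3))) : Drawn ch (t + 1) p := by
  have hlt := hch t
  have corner_lt : ∀ {u}, StackRel ch u (t + 3) → u < t + 3 := fun hu => hu.1
  have corner : ∀ {u}, StackRel ch u (t + 3) → p u = p (splitCell ch t).a ∨
      p u = p (splitCell ch t).b ∨ p u = p (splitCell ch t).c := fun hu =>
    hu.eq_corner.imp (congrArg p) (.imp (congrArg p) (congrArg p))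
  have split_edge : ∀ u v, StackRel ch u v → v < t + 3 → ∀ z ∈ segment ℝ (p u) (p v),
      ¬ (splitCell ch t).Contains p z := h.face_edge (ch t) hlt
  have split_vert : ∀ w < t + 3, ¬ (splitCell ch t).Contains p (p w) := h.face_vert (ch t) hlt
  have split_disj : ∀ j < 2 * t + 1, j ≠ ch t → ∀ z, (splitCell ch t).Contains p z →
      ¬ (cells ch t j).Contains p z := fun j hj hne => h.face_disj (ch t) hlt j hj hne.symm
  have spoke : ∀ {u z}, StackRel ch u (t + 3) → z ∈ segment ℝ (p u) (p (t + 3)) →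
      z = p u ∨ (splitCell ch t).Contains p z := fun hu hz =>
    hv.eq_or_inside_of_mem_spoke (corner hu) hz
  have last : ∀ {v}, v < t + 1 + 3 → v < t + 3 ∨ v = t + 3 := by omega
  have hv1 : Inside _ _ _ _ := (inside_rotate ..).2 hv
  have hv2 : Inside _ _ _ _ := (inside_swap_right ..).2 hv
  have cross_new : ∀ {u v x z}, StackRel ch u v → v < t + 3 → StackRel ch x (t + 3) →
      z ∈ segment ℝ (p u) (p v) → z ∈ segment ℝ (p x) (p (t + 3)) →
      (x = u ∨ x = v) ∧ p x = z := by
    intro u v x z huv hvlt hx hz hz'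
    obtain rfl := (spoke hx hz').resolve_right (split_edge u v huv hvlt z hz)
    refine ⟨?_, rfl⟩
    by_contra hne
    rw [not_or] at hne
    exact h.vert u v x huv hvlt (corner_lt hx) hne.1 hne.2 hz
  have sub_ab : ∀ {z}, Inside _ _ _ z → (splitCell ch t).Contains p z :=
    fun k => hv.of_subtriangle k
  have sub_bc : ∀ {z}, Inside _ _ _ z → (splitCell ch t).Contains p z :=
    fun k => (inside_rotate ..).1 (hv1.of_subtriangle k)
  have sub_ac : ∀ {z}, Inside _ _ _ z → (splitCell ch t).Contains p z :=
    fun k => (inside_swap_right ..).1 (hv2.of_subtriangle k)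
  have contains_cases : ∀ {i z}, i < 2 * (t + 1) + 1 → (cells ch (t + 1) i).Contains p z →
      (splitCell ch t).Contains p z ∨
        (i ≠ ch t ∧ i < 2 * t + 1 ∧ (cells ch t i).Contains p z) := by
    intro i z hi hz
    rcases cells_succ_cases hi (Cell.Contains · p z) hz with ⟨-, k⟩ | ⟨-, k⟩ | ⟨-, k⟩ | k
    · exact Or.inl (sub_ab k)
    · exact Or.inl (sub_bc k)
    · exact Or.inl (sub_ac k)
    · exact Or.inr k
  have not_spoke : ∀ {i u z}, i < 2 * (t + 1) + 1 → StackRel ch u (t + 3) →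
      z ∈ segment ℝ (p u) (p (t + 3)) → ¬ (cells ch (t + 1) i).Contains p z := by
    intro i u z hi hu hz hc
    rcases cells_succ_cases hi (Cell.Contains · p z) hc with ⟨-, k⟩ | ⟨-, k⟩ | ⟨-, k⟩ |
      ⟨k1, k2, k3⟩
    · exact hv.not_inside_of_mem_spoke (corner hu) hz k
    · exact hv1.not_inside_of_mem_spoke (by have := corner hu; tauto) hz k
    · exact hv2.not_inside_of_mem_spoke (by have := corner hu; tauto) hz k
    · rcases spoke hu hz with rfl | hz
      · exact h.face_vert i k2 u (corner_lt hu) k3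
      · exact split_disj i k2 k1 z hz k3
  constructor
  · intro u v hu hv' he
    rcases last hu with hu | rfl <;> rcases last hv' with hv' | rfl
    · exact h.inj u v hu hv' he
    · exact (split_vert u hu (he ▸ hv)).elim
    · exact (split_vert v hv' (he ▸ hv)).elim
    · rfl
  · intro u v x y huv hxy hvlt hylt hne z hz hz'
    rcases last hvlt with hvlt | rfl <;> rcases last hylt with hylt | rfl
    · exact h.cross u v x y huv hxy hvlt hylt hne z hz hz'
    · obtain ⟨k1, k2⟩ := cross_new huv hvlt hxy hz hz'
      exact ⟨x, k1, by simp, k2⟩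
    · obtain ⟨k1, k2⟩ := cross_new hxy hylt huv hz' hz
      exact ⟨u, by simp, k1, k2⟩
    · have hux : p u ≠ p x := fun e =>
        hne ⟨h.inj u x (corner_lt huv) (corner_lt hxy) e, rfl⟩
      exact ⟨t + 3, by simp, by simp,
        (hv.eq_of_mem_spokes (corner huv) (corner hxy) hux hz hz').symm⟩
  · intro u v w huv hvlt hwlt hwu hwv hz
    rcases last hvlt with hvlt | rfl <;> rcases last hwlt with hwlt | rfl
    · exact h.vert u v w huv hvlt hwlt hwu hwv hz
    · exact split_edge u v huv hvlt _ hz hv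
    · rcases spoke huv hz with e | e
      · exact hwu (h.inj w u hwlt (corner_lt huv) e)
      · exact split_vert w hwlt e
    · exact hwv rfl
  · intro i hi h0
    obtain ⟨n1, n2, n3⟩ := Inside.orients_ne_zero hv
    rcases cells_succ_cases hi (fun f => orient (p f.a) (p f.b) (p f.c) = 0) h0 with
      ⟨-, k⟩ | ⟨-, k⟩ | ⟨-, k⟩ | ⟨-, k1, k2⟩
    · exact n1 k
    · exact n2 k
    · exact n3 k
    · exact h.orient_ne i k1 k2
  · intro i hi u v huv hvlt z hz hc
    rcases last hvlt with hvlt | rfl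
    · rcases contains_cases hi hc with k | ⟨-, k1, k2⟩
      · exact split_edge u v huv hvlt z hz k
      · exact h.face_edge i k1 u v huv hvlt z hz k2
    · exact not_spoke hi huv hz hc
  · intro i hi w hw hc
    rcases last hw with hw | rfl
    · rcases contains_cases hi hc with k | ⟨-, k1, k2⟩
      · exact split_vert w hw k
      · exact h.face_vert i k1 w hw k2
    · exact not_spoke hi ⟨(isFace_cells t (ch t)).a_lt, Or.inr ⟨t, rfl, Or.inl rfl⟩⟩
        (right_mem_segment ..) hc
  · intro i hi j hj hij z hzi hzj
    have hv3 : Inside _ _ _ _ := (inside_swap ..).2 hv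
    rcases cells_succ_cases hi (Cell.Contains · p z) hzi with ⟨i1, i2⟩ | ⟨i1, i2⟩ | ⟨i1, i2⟩ |
      ⟨i1, i2, i3⟩ <;>
    rcases cells_succ_cases hj (Cell.Contains · p z) hzj with ⟨j1, j2⟩ | ⟨j1, j2⟩ | ⟨j1, j2⟩ |
      ⟨j1, j2, j3⟩
    · exact hij (i1.trans j1.symm)
    · exact hv.not_subtriangles i2 j2
    · exact hv3.not_subtriangles ((inside_swap ..).2 i2) j2
    · exact split_disj j j2 j1 z (sub_ab i2) j3
    · exact hv.not_subtriangles j2 i2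
    · exact hij (i1.trans j1.symm)
    · exact hv1.not_subtriangles i2 ((inside_swap ..).2 j2)
    · exact split_disj j j2 j1 z (sub_bc i2) j3
    · exact hv3.not_subtriangles ((inside_swap ..).2 j2) i2
    · exact hv1.not_subtriangles j2 ((inside_swap ..).2 i2)
    · exact hij (i1.trans j1.symm)
    · exact split_disj j j2 j1 z (sub_ac i2) j3
    · exact split_disj i i2 i1 z (sub_ab j2) i3
    · exact split_disj i i2 i1 z (sub_bc j2) i3
    · exact split_disj i i2 i1 z (sub_ac j2) i3
    · exact h.face_disj i i2 j j2 hij z i3 j3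

theorem drawn_stackPos {ch : ℕ → ℕ} (hch : ∀ t, ch t < 2 * t + 1) (t : ℕ) :
    Drawn ch t (stackPos ch) := by
  induction t with
  | zero => exact drawn_zero ch
  | succ t ih =>
    refine ih.succ hch ?_
    unfold Cell.Contains
    rw [stackPos]
    exact inside_centroid (ih.orient_ne (ch t) (hch t))

theorem planarEmbeddable_stackGraphFin {ch : ℕ → ℕ} (hch : ∀ t, ch t < 2 * t + 1) (m : ℕ) :
    PlanarEmbeddable (stackGraphFin ch m) := by
  have h := drawn_stackPos hch m
  have hvert : ∀ u v w : Fin (m + 3), (stackGraphFin ch m).Adj u v → w ≠ u → w ≠ v →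
      stackPos ch w ∉ segment ℝ (stackPos ch u) (stackPos ch v) := by
    rintro u v w (huv | huv) hwu hwv
    · exact h.vert u v w huv v.2 w.2 (Fin.val_ne_of_ne hwu) (Fin.val_ne_of_ne hwv)
    · rw [segment_symm]
      exact h.vert v u w huv u.2 w.2 (Fin.val_ne_of_ne hwv) (Fin.val_ne_of_ne hwu)
  refine ⟨fun k => stackPos ch k, ?_, ?_, ?_⟩
  · intro u v huv
    exact Fin.ext (h.inj u v u.2 v.2 huv)
  · have key : ∀ u v x y : Fin (m + 3), StackRel ch u v → StackRel ch x y → s(u, v) ≠ s(x, y) →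
        segment ℝ (stackPos ch u) (stackPos ch v) ∩ segment ℝ (stackPos ch x) (stackPos ch y) ⊆
        (fun k : Fin (m + 3) => stackPos ch k) ''
          (({u, v} : Set (Fin (m + 3))) ∩ ({x, y} : Set (Fin (m + 3)))) := by
      rintro u v x y huv hxy hne z ⟨hz, hz'⟩
      obtain ⟨w, hw, hw', rfl⟩ := h.cross u v x y huv hxy v.2 y.2
        (fun e => hne (by rw [Fin.ext e.1, Fin.ext e.2])) z hz hz'
      have hlt : w < m + 3 := by omega
      refine ⟨⟨w, hlt⟩, ⟨?_, ?_⟩, rfl⟩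
      · simpa [Fin.ext_iff] using hw
      · simpa [Fin.ext_iff] using hw'
    rintro u v x y (huv | huv) (hxy | hxy) hne
    · exact key u v x y huv hxy hne
    · rw [segment_symm ℝ (stackPos ch x), Set.pair_comm x]
      exact key u v y x huv hxy (by rwa [Sym2.eq_swap (a := y)])
    · rw [segment_symm ℝ (stackPos ch u), Set.pair_comm u]
      exact key v u x y huv hxy (by rwa [Sym2.eq_swap (a := v)])
    · rw [segment_symm ℝ (stackPos ch u), Set.pair_comm u, segment_symm ℝ (stackPos ch x),
        Set.pair_comm x]
      exact key v u y x huv hxy (by rwa [Sym2.eq_swap (a := v), Sym2.eq_swap (a := y)])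
  · intro u v w huv hwu hwv hw
    exact hvert u v w huv hwu hwv (openSegment_subset_segment _ _ _ hw)

/-- Codes of stacked triangulations with `m + 3` vertices. -/
abbrev StackCode (m : ℕ) := ∀ t : Fin m, Fin (2 * (t : ℕ) + 1)

/-- The insertion sequence given by a code. -/
def StackCode.choice {m : ℕ} (c : StackCode m) (t : ℕ) : ℕ := if h : t < m then c ⟨t, h⟩ else 0

theorem StackCode.choice_lt {m : ℕ} (c : StackCode m) (t : ℕ) : c.choice t < 2 * t + 1 := by
  unfold StackCode.choice
  split_ifs with h
  · exact (c ⟨t, h⟩).2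
  · omega

/-- The stacked triangulation given by a code. -/
def StackCode.graph {m : ℕ} (c : StackCode m) : SimpleGraph (Fin (m + 3)) :=
  stackGraphFin c.choice m

theorem StackCode.eq_of_compatible {m : ℕ} {c c' : StackCode m} {q : ℕ → Plane}
    (h : Compatible c.choice m q) (h' : Compatible c'.choice m q) : c = c' := by
  funext t
  have := Compatible.code_unique c.choice_lt c'.choice_lt h h' t.2
  simpa [StackCode.choice, Fin.ext_iff] using this

theorem StackCode.graph_injective (m : ℕ) :
    Function.Injective (StackCode.graph : StackCode m → SimpleGraph (Fin (m + 3))) := by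
  intro c c' h
  obtain ⟨p, hp⟩ := planarEmbeddable_stackGraphFin c.choice_lt m
  have hp' : IsSLEmbedding (stackGraphFin c'.choice m) p := by
    change stackGraphFin c.choice m = stackGraphFin c'.choice m at h
    rwa [← h]
  exact StackCode.eq_of_compatible (hp.compatible c.choice_lt fun _ _ _ => id)
    (hp'.compatible c'.choice_lt fun _ _ _ => id)

theorem card_stackCode (m : ℕ) :
    Fintype.card (StackCode m) = ∏ t ∈ Finset.range m, (2 * t + 1) := by
  rw [Fintype.card_pi, Finset.prod_range]
  simp

/-- A simultaneous drawing of stacked triangulations yields a point configuration in general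
position and relabellings under which it is compatible with all of the codes. -/
theorem exists_compatible_of_simultaneouslyEmbeddable {m k : ℕ} (τ : Fin (k + 1) → StackCode m)
    (h : SimultaneouslyEmbeddable (Set.range fun i => (τ i).graph)) :
    ∃ q : Fin (m + 3) → Plane, GenPos q ∧ ∃ σ : Fin (k + 1) → Equiv.Perm (Fin (m + 3)),
      σ 0 = 1 ∧ ∀ i, Compatible (τ i).choice m fun x => q (σ i (Fin.ofNat (m + 3) x)) := by
  obtain ⟨P, -, hP⟩ := h
  choose π hπ hrange using fun i => hP _ (Set.mem_range_self i)
  obtain ⟨q, hq, hpq⟩ := exists_genPos_perturbation (π 0)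
  let σ : Fin (k + 1) → Equiv.Perm (Fin (m + 3)) := fun i =>
    (Equiv.ofInjective (π i) (hπ i).1).trans
      ((Equiv.setCongr ((hrange i).trans (hrange 0).symm)).trans
        (Equiv.ofInjective (π 0) (hπ 0).1).symm)
  have hσ : ∀ i x, π 0 (σ i x) = π i x := fun i x => by
    simp [σ, Equiv.apply_ofInjective_symm]
  refine ⟨q, hq, σ, ?_, fun i => ?_⟩
  · ext x
    rw [(hπ 0).1 (hσ 0 x), Equiv.Perm.one_apply]
  · refine (hπ i).compatible (q := fun x => q (σ i x)) (τ i).choice_lt ?_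
    intro a b c habc
    rw [← hσ i a, ← hσ i b, ← hσ i c] at habc
    exact hpq _ _ _ habc

theorem card_le_of_simultaneouslyEmbeddable {m k : ℕ}
    (h : ∀ τ : Fin (k + 1) → StackCode m,
      SimultaneouslyEmbeddable (Set.range fun i => (τ i).graph)) :
    (∏ t ∈ Finset.range m, (2 * t + 1)) ^ (k + 1) ≤
      ((m + 2 + 1).choose 3 + 1) * ((m + 2 + (m + 2) + 1) * (2 ^ (m + 2 + (m + 2)) *
        (((m + 2 + 1).choose 3 + (m + 2 + (m + 2))).choose (m + 2 + (m + 2)) * 8 ^ (m + 2)))) *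
      (m + 3).factorial ^ k := by
  classical
  choose q hq σ hσ hc using fun τ => exists_compatible_of_simultaneouslyEmbeddable τ (h τ)
  let S : Finset (Triple (m + 2 + 1) → Bool) :=
    Finset.univ.filter fun s => ∃ p : Fin (m + 2 + 1) → Plane, GenPos p ∧ chirotope p = s
  have hS := card_chirotopes_le (m + 2) S fun s hs => (Finset.mem_filter.1 hs).2
  let F : (Fin (k + 1) → StackCode m) → S × (Fin k → Equiv.Perm (Fin (m + 3))) := fun τ =>
    (⟨chirotope (q τ), Finset.mem_filter.2 ⟨Finset.mem_univ _, q τ, hq τ, rfl⟩⟩,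
      fun i => σ τ i.succ)
  have hF : Function.Injective F := by
    intro τ τ' e
    have e1 : chirotope (q τ) = chirotope (q τ') := congrArg (fun x => x.1.1) e
    have e2 : σ τ = σ τ' := by
      funext i
      refine Fin.cases ?_ (fun j => ?_) i
      · rw [hσ, hσ]
      · exact congrFun (congrArg Prod.snd e) j
    funext i
    refine StackCode.eq_of_compatible (hc τ i) ((hc τ' i).congr fun a b c => ?_)
    rw [e2]
    exact orient_pos_iff_of_chirotope_eq (hq τ') (hq τ) e1.symm _ _ _
  have hcard := Fintype.card_le_of_injective F hF
  rw [Fintype.card_fun, Fintype.card_prod, Fintype.card_fun, card_stackCode, Fintype.card_perm,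
    Fintype.card_coe, Fintype.card_fin, Fintype.card_fin, Fintype.card_fin] at hcard
  exact hcard.trans (Nat.mul_le_mul_right _ hS)

/-- If there are more tuples of stacked triangulations than ways to draw them, then some tuple
forms a conflict collection. -/
theorem exists_conflictCollection {m k : ℕ}
    (h : ((m + 2 + 1).choose 3 + 1) * ((m + 2 + (m + 2) + 1) * (2 ^ (m + 2 + (m + 2)) *
        (((m + 2 + 1).choose 3 + (m + 2 + (m + 2))).choose (m + 2 + (m + 2)) * 8 ^ (m + 2)))) *
      (m + 3).factorial ^ k < (∏ t ∈ Finset.range m, (2 * t + 1)) ^ (k + 1))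
    (hk : k + 1 ≤ ∏ t ∈ Finset.range m, (2 * t + 1)) :
    ∃ 𝒢 : Finset (SimpleGraph (Fin (m + 3))),
      ConflictCollection (↑𝒢 : Set (SimpleGraph (Fin (m + 3)))) ∧ 𝒢.card = k + 1 := by
  classical
  have hτ : ∃ τ : Fin (k + 1) → StackCode m,
      ¬ SimultaneouslyEmbeddable (Set.range fun i => (τ i).graph) := by
    by_contra! hall
    exact (card_le_of_simultaneouslyEmbeddable hall).not_gt h
  obtain ⟨τ, hτ⟩ := hτ
  have hcard : (Finset.univ.image τ).card ≤ k + 1 := by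
    simpa using Finset.card_image_le (s := Finset.univ) (f := τ)
  obtain ⟨C, hC, hCcard⟩ := Finset.exists_superset_card_eq hcard (by rwa [card_stackCode])
  refine ⟨C.image StackCode.graph, ⟨?_, ?_⟩, ?_⟩
  · intro G hG
    obtain ⟨c, -, rfl⟩ := Finset.mem_image.1 (Finset.mem_coe.1 hG)
    exact planarEmbeddable_stackGraphFin c.choice_lt m
  · rintro ⟨P, hP, hall⟩
    refine hτ ⟨P, hP, ?_⟩
    rintro _ ⟨i, rfl⟩
    exact hall _ (Finset.mem_coe.2 (Finset.mem_image_of_mem _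
      (hC (Finset.mem_image_of_mem _ (Finset.mem_univ i)))))
  · rw [Finset.card_image_of_injective _ (StackCode.graph_injective m), hCcard]

theorem prod_odd_eq (m : ℕ) :
    ∏ t ∈ Finset.range m, (2 * t + 1) = (2 * m).factorial / (2 ^ m * m.factorial) := by
  have h : (∏ t ∈ Finset.range m, (2 * t + 1)) * (2 ^ m * m.factorial) = (2 * m).factorial := by
    induction m with
    | zero => simp
    | succ m ih =>
      rw [Finset.prod_range_succ, show 2 * (m + 1) = 2 * m + 1 + 1 by ring,
        Nat.factorial_succ (2 * m + 1),
        Nat.factorial_succ (2 * m), Nat.factorial_succ m, ← ih]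
      ring
  rw [← h, Nat.mul_div_cancel _ (by positivity)]

set_option maxRecDepth 100000 in
theorem counting_inequality_aux : ∀ d < 87,
    ((104 + d + 2 + 1).descFactorial 3 / 6 + 1) * ((104 + d + 2 + (104 + d + 2) + 1) *
      (2 ^ (104 + d + 2 + (104 + d + 2)) *
        (((104 + d + 2 + 1).descFactorial 3 / 6 + (104 + d + 2 + (104 + d + 2))).descFactorial
          (104 + d + 2 + (104 + d + 2)) / (104 + d + 2 + (104 + d + 2)).factorial *
            8 ^ (104 + d + 2)))) * (104 + d + 3).factorial ^ 29 <
      ((2 * (104 + d)).factorial / (2 ^ (104 + d) * (104 + d).factorial)) ^ 30 := by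
  decide +kernel

theorem counting_inequality {m : ℕ} (h₁ : 104 ≤ m) (h₂ : m ≤ 190) :
    ((m + 2 + 1).choose 3 + 1) * ((m + 2 + (m + 2) + 1) * (2 ^ (m + 2 + (m + 2)) *
        (((m + 2 + 1).choose 3 + (m + 2 + (m + 2))).choose (m + 2 + (m + 2)) * 8 ^ (m + 2)))) *
      (m + 3).factorial ^ 29 < (∏ t ∈ Finset.range m, (2 * t + 1)) ^ 30 := by
  obtain ⟨d, rfl⟩ := Nat.exists_eq_add_of_le h₁
  rw [prod_odd_eq, Nat.choose_eq_descFactorial_div_factorial,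
    Nat.choose_eq_descFactorial_div_factorial]
  exact counting_inequality_aux d (by omega)

theorem thirty_le_prod_odd {m : ℕ} (h : 104 ≤ m) : 30 ≤ ∏ t ∈ Finset.range m, (2 * t + 1) :=
  calc 30 ≤ ∏ t ∈ Finset.range 4, (2 * t + 1) := by decide
    _ ≤ ∏ t ∈ Finset.range m, (2 * t + 1) :=
      Finset.prod_le_prod_of_subset_of_one_le' (Finset.range_subset_range.2 (by omega))
        fun _ _ _ => by omega

theorem exists_conflictCollection_thirty {n : ℕ} (h₁ : 107 ≤ n) (h₂ : n ≤ 193) :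
    ∃ 𝒢 : Finset (SimpleGraph (Fin n)),
      ConflictCollection (↑𝒢 : Set (SimpleGraph (Fin n))) ∧ 𝒢.card = 30 := by
  obtain ⟨m, rfl⟩ : ∃ m, n = m + 3 := ⟨n - 3, by omega⟩
  exact exists_conflictCollection (k := 29) (counting_inequality (by omega) (by omega))
    (thirty_le_prod_odd (by omega))

/-- For every `107 ≤ n ≤ 193` there exists a conflict collection of `n`-vertex graphs
of size at most `30`; in particular, some conflict collection of exactly `30`
planar-embeddable graphs exists. -/
theorem conflict_collection_thirty :
    (∀ n : ℕ, 107 ≤ n → n ≤ 193 →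
      ∃ 𝒢 : Finset (SimpleGraph (Fin n)),
        ConflictCollection (↑𝒢 : Set (SimpleGraph (Fin n))) ∧ 𝒢.card ≤ 30) ∧
    (∃ (n : ℕ) (𝒢 : Finset (SimpleGraph (Fin n))),
        ConflictCollection (↑𝒢 : Set (SimpleGraph (Fin n))) ∧ 𝒢.card = 30) := by
  refine ⟨fun n h₁ h₂ => ?_, 107, exists_conflictCollection_thirty le_rfl (by norm_num)⟩
  obtain ⟨𝒢, h𝒢, hcard⟩ := exists_conflictCollection_thirty h₁ h₂
  exact ⟨𝒢, h𝒢, hcard.le⟩
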